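/- Let 1 < p < ∞ and let 𝓜 be a nonzero prime ideal in the ring M^p which is not dense in (M^p, ρ_p). Then 𝓜 contains a Blaschke product (finite or infinite) that is not identically zero. -/

import Mathlib

open MeasureTheory Filter Set
open scoped ENNReal Topology Real NNReal

noncomputable section

/-- The open unit disk in the complex plane. -/
def unitDisk : Set ℂ := Metric.ball 0 1

/-- The point `r·e^{iθ}`. -/
def circlePt (r θ : ℝ) : ℂ := (r : ℂ) * Complex.exp (θ * Complex.I)

/-- The maximal radial function `Mf(θ) = sup_{0 ≤ r < 1} |f(r e^{iθ})|`, valued in `ℝ≥0∞`. -/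
def maxRad (f : ℂ → ℂ) (θ : ℝ) : ℝ≥0∞ :=
  ⨆ r ∈ Set.Ico (0 : ℝ) 1, (‖f (circlePt r θ)‖₊ : ℝ≥0∞)

/-- `log⁺` on `ℝ≥0∞`. -/
def elogPlus (x : ℝ≥0∞) : ℝ≥0∞ :=
  if x = ∞ then ∞ else ENNReal.ofReal (Real.log x.toReal)

/-- `x ↦ log (1 + x)` on `ℝ≥0∞`. -/
def elog1p (x : ℝ≥0∞) : ℝ≥0∞ :=
  if x = ∞ then ∞ else ENNReal.ofReal (Real.log (1 + x.toReal))

/-- The radial boundary value `f*(e^{iθ}) = lim_{r→1⁻} f(r e^{iθ})`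
(a junk value is returned where the limit does not exist). -/
def radialLimit (f : ℂ → ℂ) (θ : ℝ) : ℂ :=
  limUnder (nhdsWithin (1 : ℝ) (Set.Iio 1)) fun r : ℝ => f (circlePt r θ)

/-- The class `M^p`: holomorphic functions on the unit disk with
`∫₀^{2π} (log⁺ Mf(θ))^p dθ/2π < ∞`. -/
def MpClass (p : ℝ) : Set (ℂ → ℂ) :=
  {f | DifferentiableOn ℂ f unitDisk ∧
    (∫⁻ θ in Set.Ioc 0 (2 * π), elogPlus (maxRad f θ) ^ p) / ENNReal.ofReal (2 * π) < ∞}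

/-- The metric `ρ_p` on `M^p`. -/
def rhoMetric (p : ℝ) (f g : ℂ → ℂ) : ℝ≥0∞ :=
  ((∫⁻ θ in Set.Ioc 0 (2 * π), elog1p (maxRad (f - g) θ) ^ p) /
    ENNReal.ofReal (2 * π)) ^ (1 / p)

/-- The Privalov class `N^p`: holomorphic functions on the unit disk with
`sup_{0≤r<1} ∫₀^{2π} (log⁺|f(re^{iθ})|)^p dθ/2π < ∞`. -/
def NpClass (p : ℝ) : Set (ℂ → ℂ) :=
  {f | DifferentiableOn ℂ f unitDisk ∧
    (⨆ r ∈ Set.Ico (0 : ℝ) 1,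
      (∫⁻ θ in Set.Ioc 0 (2 * π),
        ENNReal.ofReal (Real.log ‖f (circlePt r θ)‖) ^ p) / ENNReal.ofReal (2 * π)) < ∞}

/-- The metric `d_p` on `N^p`, defined via boundary values. -/
def dMetric (p : ℝ) (f g : ℂ → ℂ) : ℝ≥0∞ :=
  ((∫⁻ θ in Set.Ioc 0 (2 * π),
      ENNReal.ofReal (Real.log (1 + ‖radialLimit f θ - radialLimit g θ‖)) ^ p) /
    ENNReal.ofReal (2 * π)) ^ (1 / p)

/-- The Hardy space `H^p`. -/
def HpClass (p : ℝ) : Set (ℂ → ℂ) :=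
  {f | DifferentiableOn ℂ f unitDisk ∧
    (⨆ r ∈ Set.Ico (0 : ℝ) 1,
      (∫⁻ θ in Set.Ioc 0 (2 * π), (‖f (circlePt r θ)‖₊ : ℝ≥0∞) ^ p) /
        ENNReal.ofReal (2 * π)) < ∞}

/-- The Smirnov class `N⁺`. -/
def SmirnovClass : Set (ℂ → ℂ) :=
  {f | DifferentiableOn ℂ f unitDisk ∧
    (∫⁻ θ in Set.Ioc 0 (2 * π), ENNReal.ofReal (Real.log ‖radialLimit f θ‖)) /
      ENNReal.ofReal (2 * π) < ∞ ∧
    Tendsto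
      (fun r : ℝ => (∫⁻ θ in Set.Ioc 0 (2 * π),
        ENNReal.ofReal (Real.log ‖f (circlePt r θ)‖)) / ENNReal.ofReal (2 * π))
      (nhdsWithin (1 : ℝ) (Set.Iio 1))
      (nhds ((∫⁻ θ in Set.Ioc 0 (2 * π),
        ENNReal.ofReal (Real.log ‖radialLimit f θ‖)) / ENNReal.ofReal (2 * π)))}

/-- The normalized Blaschke factor `(|a|/a)·(a − z)/(1 − conj a · z)`. -/
def blaschkeFactor (a z : ℂ) : ℂ :=
  ((‖a‖ : ℂ) / a) * ((a - z) / (1 - (starRingEnd ℂ) a * z))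

/-- `B` is a (finite or infinite) Blaschke product on the unit disk. -/
def IsBlaschkeProduct (B : ℂ → ℂ) : Prop :=
  ∃ m : ℕ,
    (∃ n : ℕ, ∃ a : ℕ → ℂ, (∀ k < n, a k ∈ unitDisk ∧ a k ≠ 0) ∧
      ∀ z ∈ unitDisk, B z = z ^ m * ∏ k ∈ Finset.range n, blaschkeFactor (a k) z) ∨
    (∃ a : ℕ → ℂ, (∀ k, a k ∈ unitDisk ∧ a k ≠ 0) ∧ (Summable fun k => 1 - ‖a k‖) ∧
      ∀ z ∈ unitDisk, B z = z ^ m * ∏' k, blaschkeFactor (a k) z)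

/-- `I` is an ideal of the ring `M^p`. -/
structure IsIdealIn (p : ℝ) (I : Set (ℂ → ℂ)) : Prop where
  subset : I ⊆ MpClass p
  zero_mem : (0 : ℂ → ℂ) ∈ I
  add_mem : ∀ f ∈ I, ∀ g ∈ I, f + g ∈ I
  neg_mem : ∀ f ∈ I, -f ∈ I
  mul_mem : ∀ f ∈ MpClass p, ∀ g ∈ I, f * g ∈ I

/-- `I` is a prime ideal of the ring `M^p`: an ideal such that whenever a product of two
elements of `M^p` lies in `I`, one of the factors lies in `I`. -/
def IsPrimeIdealIn (p : ℝ) (I : Set (ℂ → ℂ)) : Prop :=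
  IsIdealIn p I ∧ ∀ f ∈ MpClass p, ∀ g ∈ MpClass p, f * g ∈ I → f ∈ I ∨ g ∈ I

/-- `I` is a dense subset of the metric space `(M^p, ρ_p)`. -/
def IsDenseIn (p : ℝ) (I : Set (ℂ → ℂ)) : Prop :=
  ∀ f ∈ MpClass p, ∀ ε : ℝ≥0∞, 0 < ε → ∃ g ∈ I, rhoMetric p f g < ε

/-- `I` is an ideal of the ring `N^p`. -/
structure IsIdealInNp (p : ℝ) (I : Set (ℂ → ℂ)) : Prop where
  subset : I ⊆ NpClass p
  zero_mem : (0 : ℂ → ℂ) ∈ I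
  add_mem : ∀ f ∈ I, ∀ g ∈ I, f + g ∈ I
  neg_mem : ∀ f ∈ I, -f ∈ I
  mul_mem : ∀ f ∈ NpClass p, ∀ g ∈ I, f * g ∈ I

/-- `I` is a prime ideal of the ring `N^p`. -/
def IsPrimeIdealInNp (p : ℝ) (I : Set (ℂ → ℂ)) : Prop :=
  IsIdealInNp p I ∧ ∀ f ∈ NpClass p, ∀ g ∈ NpClass p, f * g ∈ I → f ∈ I ∨ g ∈ I

/-- `I` is a dense subset of the metric space `(N^p, d_p)`. -/
def IsDenseInNp (p : ℝ) (I : Set (ℂ → ℂ)) : Prop :=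
  ∀ f ∈ NpClass p, ∀ ε : ℝ≥0∞, 0 < ε → ∃ g ∈ I, dMetric p f g < ε


open Metric in
theorem hl_weak (v : ℝ → ℝ≥0∞) (lam C : ℝ≥0∞) (hl : lam ≠ 0) (hl' : lam ≠ ∞) (hC : C ≠ ∞)
    (hv : ∫⁻ t, v t ≤ C) (E : Set ℝ)
    (hE : ∀ x ∈ E, ∃ h : ℝ, 0 < h ∧ lam * ENNReal.ofReal h ≤ ∫⁻ t in closedBall x h, v t) :
    volume E ≤ 10 * C / lam := by
  choose! h hpos hh using hE
  have hbd : ∀ x ∈ E, h x ≤ (C / lam).toReal := by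
    intro x hx
    have h1 : lam * ENNReal.ofReal (h x) ≤ C :=
      (hh x hx).trans ((setLIntegral_le_lintegral _ _).trans hv)
    have h2 : ENNReal.ofReal (h x) ≤ C / lam := by
      rw [ENNReal.le_div_iff_mul_le (Or.inl hl) (Or.inl hl'), mul_comm]; exact h1
    exact (ENNReal.ofReal_le_iff_le_toReal (ENNReal.div_ne_top hC hl)).1 h2
  obtain ⟨u, huE, hdisj, hcov⟩ := Vitali.exists_disjoint_subfamily_covering_enlargement_closedBall
    E (fun x => x) h (C / lam).toReal hbd 5 (by norm_num)
  have hcount : u.Countable := by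
    apply Set.PairwiseDisjoint.countable_of_nonempty_interior hdisj
    intro x hx
    refine ⟨x, ?_⟩
    exact interior_mono ball_subset_closedBall
      (by rw [isOpen_ball.interior_eq]; exact mem_ball_self (hpos x (huE hx)))
  have hsub : E ⊆ ⋃ b ∈ u, closedBall b (5 * h b) := by
    intro x hx
    obtain ⟨b, hb, hbb⟩ := hcov x hx
    exact mem_biUnion hb (hbb (mem_closedBall_self (hpos x hx).le))
  have hvol : ∀ b : ℝ, volume (closedBall b (5 * h b)) = 10 * ENNReal.ofReal (h b) := by
    intro b
    rw [Real.volume_closedBall, show 2 * (5 * h b) = 10 * h b by ring,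
      ENNReal.ofReal_mul (by norm_num)]
    norm_num
  have key : lam * volume E ≤ 10 * C := by
    have := hcount.to_subtype
    calc lam * volume E ≤ lam * volume (⋃ b ∈ u, closedBall b (5 * h b)) := by gcongr
      _ ≤ lam * ∑' b : u, volume (closedBall (b:ℝ) (5 * h b)) := by
        gcongr; exact measure_biUnion_le _ hcount _
      _ = 10 * ∑' b : u, lam * ENNReal.ofReal (h b) := by
        simp_rw [hvol]
        rw [ENNReal.tsum_mul_left, ENNReal.tsum_mul_left]; ring
      _ ≤ 10 * ∑' b : u, ∫⁻ t in closedBall (b:ℝ) (h b), v t := by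
        gcongr with b
        exact hh b (huE b.2)
      _ = 10 * ∫⁻ t in ⋃ b ∈ u, closedBall (b:ℝ) (h b), v t := by
        rw [lintegral_biUnion hcount (fun b _ => measurableSet_closedBall) hdisj]
      _ ≤ 10 * C := by
        gcongr
        exact (setLIntegral_le_lintegral _ _).trans hv
  rw [ENNReal.le_div_iff_mul_le (Or.inl hl) (Or.inl hl'), mul_comm]
  exact key

theorem kern_dyadic (t δ : ℝ) (hδ : 0 < δ) (K : ℝ) (hK0 : 0 ≤ K)
    (h1 : K ≤ 1 / δ) (h2 : K * t ^ 2 ≤ δ) :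
    ENNReal.ofReal K ≤ ∑' j : ℕ, (Set.indicator (Metric.closedBall (0:ℝ) (2 ^ j * δ))
      (fun _ => ENNReal.ofReal (4 / (4 ^ j * δ))) t) := by
  have hex : ∃ j : ℕ, |t| ≤ 2 ^ j * δ := by
    obtain ⟨j, hj⟩ := pow_unbounded_of_one_lt (|t| / δ) (by norm_num : (1:ℝ) < 2)
    exact ⟨j, ((div_lt_iff₀ hδ).1 hj).le⟩
  classical
  set j := Nat.find hex with hjd
  have hj : |t| ≤ 2 ^ j * δ := Nat.find_spec hex
  refine le_trans ?_ (ENNReal.le_tsum j)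
  rw [Set.indicator_of_mem (by simpa using hj)]
  apply ENNReal.ofReal_le_ofReal
  rcases Nat.eq_zero_or_pos j with h0 | h0
  · rw [h0]; refine h1.trans ?_
    rw [pow_zero, one_mul]; gcongr; norm_num
  · have hlt : 2 ^ (j - 1) * δ < |t| := by
      have := Nat.find_min hex (m := j - 1) (by omega)
      push Not at this; exact this
    obtain ⟨i, hi⟩ : ∃ i, j = i + 1 := ⟨j - 1, by omega⟩
    rw [hi] at hlt ⊢
    simp only [Nat.add_sub_cancel] at hlt
    have hp : (0:ℝ) < 2 ^ i * δ := by positivity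
    have hsq : (2 ^ i * δ) ^ 2 ≤ t ^ 2 := by
      rw [← sq_abs t]; gcongr
    have h3 : K * (2 ^ i * δ) ^ 2 ≤ δ := (mul_le_mul_of_nonneg_left hsq hK0).trans h2
    have h4 : (2 ^ i * δ) ^ 2 = 4 ^ i * δ * δ := by
      rw [show (4:ℝ) = 2 ^ 2 by norm_num, ← pow_mul]; ring
    rw [h4] at h3
    have h5 : K * (4 ^ i * δ) ≤ 1 := by
      nlinarith
    rw [le_div_iff₀ (by positivity), pow_succ]
    linarith

theorem poisson_le_aux (v : ℝ → ℝ≥0∞) (hv : Measurable v) (θ : ℝ) (A : ℝ≥0∞)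
    (hA : ∀ h : ℝ, 0 < h → ∫⁻ t in Metric.closedBall θ h, v t ≤ A * ENNReal.ofReal h)
    (δ : ℝ) (hδ : 0 < δ) (S : Set ℝ) (hS : MeasurableSet S) (k : ℝ → ℝ) (hk0 : ∀ t ∈ S, 0 ≤ k t)
    (hk1 : ∀ t ∈ S, k t ≤ 1 / δ) (hk2 : ∀ t ∈ S, k t * (t - θ) ^ 2 ≤ δ) :
    ∫⁻ t in S, ENNReal.ofReal (k t) * v t ≤ 8 * A := by
  have hb : ∀ j : ℕ, ∀ t, (Set.indicator (Metric.closedBall (0:ℝ) (2 ^ j * δ))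
      (fun _ => ENNReal.ofReal (4 / (4 ^ j * δ))) (t - θ)) * v t =
      Set.indicator (Metric.closedBall θ (2 ^ j * δ))
        (fun t => ENNReal.ofReal (4 / (4 ^ j * δ)) * v t) t := by
    intro j t
    by_cases ht : t ∈ Metric.closedBall θ (2 ^ j * δ)
    · rw [Set.indicator_of_mem ht, Set.indicator_of_mem]
      simpa [Real.dist_eq] using ht
    · rw [Set.indicator_of_notMem ht, Set.indicator_of_notMem, zero_mul]
      simpa [Real.dist_eq] using ht
  calc ∫⁻ t in S, ENNReal.ofReal (k t) * v t
      ≤ ∫⁻ t in S, ∑' j : ℕ, Set.indicator (Metric.closedBall θ (2 ^ j * δ))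
        (fun t => ENNReal.ofReal (4 / (4 ^ j * δ)) * v t) t := by
        apply setLIntegral_mono' hS
        intro t ht
        simp_rw [← hb]
        rw [ENNReal.tsum_mul_right]
        gcongr
        exact kern_dyadic (t - θ) δ hδ (k t) (hk0 t ht) (hk1 t ht) (hk2 t ht)
    _ ≤ ∫⁻ t, ∑' j : ℕ, Set.indicator (Metric.closedBall θ (2 ^ j * δ))
        (fun t => ENNReal.ofReal (4 / (4 ^ j * δ)) * v t) t := setLIntegral_le_lintegral _ _
    _ = ∑' j : ℕ, ENNReal.ofReal (4 / (4 ^ j * δ)) *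
          ∫⁻ t in Metric.closedBall θ (2 ^ j * δ), v t := by
        rw [lintegral_tsum]
        · congr 1; ext j
          rw [lintegral_indicator measurableSet_closedBall, lintegral_const_mul _ hv]
        · intro j
          exact ((hv.const_mul _).indicator measurableSet_closedBall).aemeasurable
    _ ≤ ∑' j : ℕ, 4 * A * (2⁻¹ : ℝ≥0∞) ^ j := by
        refine ENNReal.tsum_le_tsum fun j => ?_
        calc _ ≤ ENNReal.ofReal (4 / (4 ^ j * δ)) * (A * ENNReal.ofReal (2 ^ j * δ)) := by
              gcongr; exact hA _ (by positivity)
          _ = A * ENNReal.ofReal (4 / (4 ^ j * δ) * (2 ^ j * δ)) := by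
              rw [ENNReal.ofReal_mul (p := 4 / (4 ^ j * δ)) (by positivity)]
              exact mul_left_comm _ _ _
          _ = A * ENNReal.ofReal (4 * (2⁻¹) ^ j) := by
              congr 2
              rw [show (4:ℝ) ^ j = 2 ^ j * 2 ^ j by rw [← mul_pow]; norm_num, inv_pow]
              field_simp
          _ = _ := by
              rw [ENNReal.ofReal_mul (by norm_num), ENNReal.ofReal_pow (by norm_num),
                ENNReal.ofReal_inv_of_pos (by norm_num)]
              simp only [ENNReal.ofReal_ofNat]; ring
    _ = 8 * A := by
        rw [ENNReal.tsum_mul_left, ENNReal.tsum_geometric, ENNReal.one_sub_inv_two, inv_inv]; ring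

theorem poisson_kernel_bounds (r θ t : ℝ) (hr0 : 0 ≤ r) (hr : r < 1) (ht : |t - θ| ≤ π) :
    0 ≤ poissonKernel 0 (circlePt r θ) (circleMap 0 1 t) ∧
    poissonKernel 0 (circlePt r θ) (circleMap 0 1 t) / 60 ≤ 1 / (1 - r) ∧
    poissonKernel 0 (circlePt r θ) (circleMap 0 1 t) / 60 * (t - θ) ^ 2 ≤ 1 - r := by
  have hd : ‖circleMap 0 1 t - circlePt r θ‖ ^ 2 = (1 - r) ^ 2 + 4 * r * Real.sin ((t - θ) / 2) ^ 2 := by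
    rw [← Complex.normSq_eq_norm_sq, Complex.normSq_apply]
    simp only [circleMap, circlePt, Complex.exp_mul_I, ← Complex.ofReal_cos, ← Complex.ofReal_sin]
    simp
    simp only [Complex.cos_ofReal_re, Complex.sin_ofReal_re]
    have h1 : Real.sin ((t - θ) / 2) ^ 2 = (1 - Real.cos (t - θ)) / 2 := by
      rw [Real.sin_sq_eq_half_sub]; ring_nf
    rw [h1, Real.cos_sub]
    nlinarith [Real.sin_sq_add_cos_sq t, Real.sin_sq_add_cos_sq θ]
  have hP : poissonKernel 0 (circlePt r θ) (circleMap 0 1 t) =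
      (1 - r ^ 2) / ((1 - r) ^ 2 + 4 * r * Real.sin ((t - θ) / 2) ^ 2) := by
    rw [poissonKernel_def]
    simp only [sub_zero]
    rw [hd]
    congr 2
    · simp
    · simp [circlePt]
  have hs : ((t - θ) / π) ^ 2 ≤ Real.sin ((t - θ) / 2) ^ 2 := by
    rw [← sq_abs ((t - θ) / π), ← sq_abs (Real.sin _)]
    have h0 := Real.mul_le_sin (x := |t - θ| / 2) (by positivity) (by linarith)
    have h1 : |Real.sin ((t - θ) / 2)| = |Real.sin (|t - θ| / 2)| := by
      rcases abs_cases (t - θ) with h | h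
      · rw [h.1]
      · rw [h.1, neg_div, Real.sin_neg, abs_neg]
    rw [h1]
    have h2 : |(t - θ) / π| = 2 / π * (|t - θ| / 2) := by
      rw [abs_div, abs_of_pos Real.pi_pos]; ring
    rw [h2]
    gcongr
    exact h0.trans (le_abs_self _)
  have hδ : 0 < 1 - r := by linarith
  set s := Real.sin ((t - θ) / 2) ^ 2 with hsd
  have hs0 : 0 ≤ s := sq_nonneg _
  have hden : 0 < (1 - r) ^ 2 + 4 * r * s := by positivity
  have hpi : π ^ 2 < 10 := by nlinarith [Real.pi_lt_d2, Real.pi_pos]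
  rw [hP]
  have hnum : 0 ≤ 1 - r ^ 2 := by nlinarith
  have hP2 : (1 - r ^ 2) / ((1 - r) ^ 2 + 4 * r * s) ≤ 2 / (1 - r) := by
    rw [div_le_div_iff₀ hden hδ]
    nlinarith [mul_nonneg hr0 hs0, mul_nonneg hr0 (sq_nonneg (1 - r)), mul_pos hδ hδ]
  have hP0 : 0 ≤ (1 - r ^ 2) / ((1 - r) ^ 2 + 4 * r * s) := by positivity
  refine ⟨hP0, ?_, ?_⟩
  · have : 2 / (1 - r) = 2 * (1 / (1 - r)) := by ring
    have h3 : 0 < 1 / (1 - r) := by positivity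
    rw [this] at hP2
    linarith
  · have htt : (t - θ) ^ 2 ≤ 10 := by
      rw [← sq_abs]; nlinarith [abs_nonneg (t - θ)]
    rcases le_total r (1 / 2) with h | h
    · have h4 : 2 / (1 - r) ≤ 4 := by
        rw [div_le_iff₀ hδ]; linarith
      have h5 : (1 - r ^ 2) / ((1 - r) ^ 2 + 4 * r * s) ≤ 3 := by
        rw [div_le_iff₀ hden]; nlinarith [mul_nonneg hr0 hs0]
      calc _ ≤ 3 / 60 * (10:ℝ) := by gcongr
        _ ≤ _ := by linarith
    · have h6 : (t - θ) ^ 2 ≤ 10 * s := by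
        have : (t - θ) ^ 2 = π ^ 2 * ((t - θ) / π) ^ 2 := by
          field_simp
        rw [this]
        calc _ ≤ π ^ 2 * s := by gcongr
          _ ≤ _ := by gcongr
      rw [div_mul_eq_mul_div, div_le_iff₀ (by norm_num), div_mul_eq_mul_div, div_le_iff₀ hden]
      calc (1 - r ^ 2) * (t - θ) ^ 2 ≤ (1 - r ^ 2) * (10 * s) := by gcongr
        _ ≤ (1 - r) * 60 * (4 * r * s) := by
          have : (1 - r ^ 2) * (10 * s) = (1 - r) * s * (10 * (1 + r)) := by ring
          rw [this]
          have : (1 - r) * 60 * (4 * r * s) = (1 - r) * s * (240 * r) := by ring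
          rw [this]
          apply mul_le_mul_of_nonneg_left _ (by positivity)
          linarith
        _ ≤ _ := by
          gcongr
          nlinarith

theorem circlePt_eq (r θ : ℝ) : circlePt r θ = r * circleMap 0 1 θ := by
  simp [circlePt, circleMap]

theorem norm_circlePt (r θ : ℝ) : ‖circlePt r θ‖ = |r| := by
  simp [circlePt]

theorem circlePt_mem (r θ : ℝ) (h0 : 0 ≤ r) (h1 : r < 1) : circlePt r θ ∈ unitDisk := by
  simp [unitDisk, norm_circlePt, abs_of_nonneg h0, h1]

theorem continuous_circlePt (r : ℝ) : Continuous (circlePt r) := by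
  unfold circlePt; fun_prop

/-- Poisson formula gives a bound of the value by the lintegral. -/
theorem poisson_enorm_le (Q : ℂ → ℂ) (hQ : DiffContOnCl ℂ Q (Metric.ball 0 1))
    (r θ : ℝ) (hr0 : 0 ≤ r) (hr : r < 1) :
    ‖Q (circlePt r θ)‖ₑ ≤ ∫⁻ t in Ioc (θ - π) (θ + π),
      ENNReal.ofReal (poissonKernel 0 (circlePt r θ) (circleMap 0 1 t)) * ‖Q (circleMap 0 1 t)‖ₑ := by
  have hw : circlePt r θ ∈ Metric.ball (0:ℂ) 1 := circlePt_mem r θ hr0 hr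
  have h := hQ.circleAverage_poissonKernel_smul hw
  rw [← h, Real.circleAverage_eq_integral_add (θ - π),
    intervalIntegral.integral_comp_add_right
      (fun t => (poissonKernel 0 (circlePt r θ) • Q) (circleMap 0 1 t)),
    show (0:ℝ) + (θ - π) = θ - π by ring, show 2 * π + (θ - π) = θ + π by ring,
    intervalIntegral.integral_of_le (by linarith [Real.pi_pos]), enorm_smul]
  have h1 : ‖((2 * π)⁻¹ : ℝ)‖ₑ ≤ 1 := by
    rw [Real.enorm_eq_ofReal (by positivity), ← ENNReal.ofReal_one]
    apply ENNReal.ofReal_le_ofReal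
    apply inv_le_one_of_one_le₀
    linarith [Real.pi_gt_three]
  refine (mul_le_of_le_one_left' h1).trans ?_
  · · 
      refine (enorm_integral_le_lintegral_enorm _).trans ?_
      apply setLIntegral_mono' measurableSet_Ioc
      intro t ht
      simp only [Pi.smul_apply', enorm_smul]
      gcongr
      rw [Real.enorm_eq_ofReal]
      refine (poisson_kernel_bounds r θ t hr0 hr ?_).1
      rw [abs_le]; constructor <;> linarith [ht.1, ht.2]

theorem lintegral_periodic_three (g : ℝ → ℝ≥0∞) (hg : Function.Periodic g (2 * π)) :
    ∫⁻ t in Ioc (-(2 * π)) (4 * π), g t = 3 * ∫⁻ t in Ioc 0 (2 * π), g t := by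
  have hs : ∀ a : ℝ, ∫⁻ t in Ioc a (a + 2 * π), g t = ∫⁻ t in Ioc 0 (0 + 2 * π), g t := by
    intro a
    have : Fact (0 < 2 * π) := ⟨by positivity⟩
    have h1 := isAddFundamentalDomain_Ioc (T := 2 * π) (by positivity) a
    have h2 := isAddFundamentalDomain_Ioc (T := 2 * π) (by positivity) 0
    apply h1.setLIntegral_eq h2
    rintro ⟨_, n, rfl⟩ x
    simpa [AddSubgroup.vadd_def, add_comm] using (hg.zsmul n) x
  have e1 : Ioc (-(2 * π)) (4 * π) =
      (Ioc (-(2*π)) (-(2*π) + 2 * π) ∪ Ioc 0 (0 + 2 * π)) ∪ Ioc (2 * π) (2 * π + 2 * π) := by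
    have := Real.pi_pos
    rw [show -(2*π) + 2 * π = 0 by ring, show 0 + 2 * π = 2 * π by ring,
      show 2 * π + 2 * π = 4 * π by ring, Ioc_union_Ioc_eq_Ioc (by linarith) (by linarith),
      Ioc_union_Ioc_eq_Ioc (by linarith) (by linarith)]
  rw [e1, lintegral_union measurableSet_Ioc, lintegral_union measurableSet_Ioc, hs (-(2 * π)), hs (2 * π)]
  · rw [zero_add]; ring
  · rw [Set.disjoint_left]; intro x hx hy
    linarith [hx.2, hy.1]
  · rw [Set.disjoint_left]; rintro x (hx | hx) hy <;> 
    linarith [hx.2, hy.1, Real.pi_pos]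

theorem weak_type_disk (Q : ℂ → ℂ) (hQ : DiffContOnCl ℂ Q (Metric.ball 0 1)) (C : ℝ≥0∞)
    (hC : C ≠ ∞) (hbdInt : ∫⁻ t in Ioc 0 (2 * π), ‖Q (circleMap 0 1 t)‖ₑ ≤ C)
    (A : ℝ≥0∞) (hA0 : A ≠ 0) (hA : A ≠ ∞) :
    volume {θ ∈ Ioc (0:ℝ) (2 * π) | ∃ r ∈ Ico (0:ℝ) 1, 480 * A < ‖Q (circlePt r θ)‖ₑ}
      ≤ 10 * (3 * C) / A := by
  set S : Set ℝ := Ioc (-(2 * π)) (4 * π) with hS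
  have hcont : Continuous fun t : ℝ => Q (circleMap 0 1 t) := by
    have : ContinuousOn Q (closure (Metric.ball 0 1)) := hQ.2
    rw [closure_ball _ one_ne_zero] at this
    exact this.comp_continuous (continuous_circleMap 0 1) (fun t => by simp)
  set v : ℝ → ℝ≥0∞ := S.indicator fun t => ‖Q (circleMap 0 1 t)‖ₑ with hv
  have hvm : Measurable v := hcont.enorm.measurable.indicator measurableSet_Ioc
  apply hl_weak v A (3 * C) hA0 hA (by finiteness)
  · rw [hv, lintegral_indicator measurableSet_Ioc, lintegral_periodic_three]
    · gcongr
    · intro t; simp [periodic_circleMap 0 1 t]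
  · rintro θ ⟨hθ, r, ⟨hr0, hr⟩, hlt⟩
    by_contra! hcon
    apply absurd hlt (not_lt.2 _)
    have hbd : ∀ t ∈ Ioc (θ - π) (θ + π), |t - θ| ≤ π := by
      intro t ht
      rw [abs_le]; constructor <;> linarith [ht.1, ht.2]
    have := poisson_le_aux v hvm θ A (fun h hh => (hcon h hh).le) (1 - r) (by linarith)
      (Ioc (θ - π) (θ + π)) measurableSet_Ioc
      (fun t => poissonKernel 0 (circlePt r θ) (circleMap 0 1 t) / 60)
      (fun t ht => div_nonneg (poisson_kernel_bounds r θ t hr0 hr (hbd t ht)).1 (by norm_num))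
      (fun t ht => (poisson_kernel_bounds r θ t hr0 hr (hbd t ht)).2.1)
      (fun t ht => (poisson_kernel_bounds r θ t hr0 hr (hbd t ht)).2.2)
    calc ‖Q (circlePt r θ)‖ₑ ≤ _ := poisson_enorm_le Q hQ r θ hr0 hr
      _ = ∫⁻ t in Ioc (θ - π) (θ + π), 60 * (ENNReal.ofReal
          (poissonKernel 0 (circlePt r θ) (circleMap 0 1 t) / 60) * v t) := by
        apply setLIntegral_congr_fun measurableSet_Ioc
        intro t ht
        have hp := Real.pi_pos
        have : t ∈ S := ⟨by linarith [ht.1, hθ.1], by linarith [ht.2, hθ.2]⟩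
        simp only [hv]
        rw [Set.indicator_of_mem this, ← mul_assoc]
        congr 1
        rw [show (60:ℝ≥0∞) = ENNReal.ofReal 60 by simp, ← ENNReal.ofReal_mul (by norm_num)]
        congr 1; ring
      _ = 60 * ∫⁻ t in Ioc (θ - π) (θ + π), (ENNReal.ofReal
          (poissonKernel 0 (circlePt r θ) (circleMap 0 1 t) / 60) * v t) := by
        rw [lintegral_const_mul']; norm_num
      _ ≤ 60 * (8 * A) := by gcongr
      _ = 480 * A := by ring

/-- Radial maximal functions of `H^1` functions are finite a.e. -/
theorem maxRad_ae_lt_top (Q : ℂ → ℂ) (hQ : DifferentiableOn ℂ Q unitDisk) (C : ℝ≥0∞) (hC : C ≠ ∞)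
    (hbdInt : ∀ R ∈ Ioo (0:ℝ) 1, ∫⁻ t in Ioc 0 (2 * π), ‖Q (circlePt R t)‖ₑ ≤ C) :
    ∀ᵐ θ ∂(volume.restrict (Ioc 0 (2 * π))), maxRad Q θ < ∞ := by
  rw [ae_restrict_iff' measurableSet_Ioc]
  set E : ℝ≥0∞ → ℝ → Set ℝ := fun A R =>
    {θ ∈ Ioc (0:ℝ) (2 * π) | ∃ r ∈ Ico (0:ℝ) 1, r < R ∧ 480 * A < ‖Q (circlePt r θ)‖ₑ} with hE
  have hER : ∀ A : ℝ≥0∞, A ≠ 0 → A ≠ ∞ → ∀ R ∈ Ioo (0:ℝ) 1,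
      volume (E A R) ≤ 10 * (3 * C) / A := by
    intro A hA0 hA R hR
    have hd : DiffContOnCl ℂ (fun z => Q (R * z)) (Metric.ball 0 1) := by
      apply DifferentiableOn.diffContOnCl
      rw [closure_ball _ one_ne_zero]
      apply hQ.comp (by fun_prop)
      intro z hz
      simp only [unitDisk, Metric.mem_ball, dist_zero_right, norm_mul, Complex.norm_real,
        Real.norm_eq_abs, abs_of_pos hR.1]
      have : ‖z‖ ≤ 1 := by simpa using hz
      nlinarith [hR.1, hR.2]
    have := weak_type_disk _ hd C hC
      (by simpa only [← circlePt_eq] using hbdInt R hR) A hA0 hA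
    refine (measure_mono ?_).trans this
    rintro θ ⟨hθ, r, hr, hrR, hlt⟩
    refine ⟨hθ, r / R, ⟨div_nonneg hr.1 hR.1.le, (div_lt_one hR.1).2 hrR⟩, ?_⟩
    convert hlt using 3
    have : (R:ℂ) ≠ 0 := by exact_mod_cast hR.1.ne'
    simp only [circlePt]
    push_cast
    field_simp
  have hE1 : ∀ A : ℝ≥0∞, A ≠ 0 → A ≠ ∞ → volume (E A 1) ≤ 10 * (3 * C) / A := by
    intro A hA0 hA
    have hu : E A 1 ⊆ ⋃ n : ℕ, E A (1 - 1 / (n + 2)) := by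
      rintro θ ⟨hθ, r, hr, hr1, hlt⟩
      obtain ⟨n, hn⟩ := exists_nat_one_div_lt (show 0 < 1 - r by linarith)
      refine mem_iUnion.2 ⟨n, hθ, r, hr, ?_, hlt⟩
      have : 1 / ((n:ℝ) + 2) ≤ 1 / (n + 1) := by gcongr; norm_num
      linarith
    refine (measure_mono hu).trans ?_
    rw [Monotone.measure_iUnion]
    · refine iSup_le fun n => hER A hA0 hA _ ⟨?_, ?_⟩
      · have : 1 / ((n:ℝ) + 2) < 1 := by
          rw [div_lt_one (by positivity)]; linarith [(Nat.cast_nonneg n : (0:ℝ) ≤ n)]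
        linarith
      · have : 0 < 1 / ((n:ℝ) + 2) := by positivity
        linarith
    · intro m n hmn θ
      rintro ⟨hθ, r, hr, hr1, hlt⟩
      refine ⟨hθ, r, hr, lt_of_lt_of_le hr1 ?_, hlt⟩
      have : (m:ℝ) ≤ n := by exact_mod_cast hmn
      gcongr
  have hzero : volume {θ | ¬ (θ ∈ Ioc 0 (2 * π) → maxRad Q θ < ∞)} = 0 := by
    have hle : ∀ n : ℕ, volume {θ | ¬ (θ ∈ Ioc 0 (2 * π) → maxRad Q θ < ∞)} ≤
        10 * (3 * C) / ((n:ℝ≥0∞) + 1) := by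
      intro n
      refine (measure_mono ?_).trans (hE1 ((n:ℝ≥0∞) + 1) (by simp) (by finiteness))
      intro θ hθ
      simp only [Set.mem_ofPred_eq, Classical.not_imp, not_lt, top_le_iff] at hθ
      refine ⟨hθ.1, ?_⟩
      have h2 : 480 * ((n:ℝ≥0∞) + 1) < maxRad Q θ := by
        rw [hθ.2]; exact (by finiteness : 480 * ((n:ℝ≥0∞) + 1) ≠ ∞).lt_top
      unfold maxRad at h2
      simp only [lt_iSup_iff] at h2
      obtain ⟨r, hr, h3⟩ := h2
      exact ⟨r, hr, hr.2, h3⟩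
    have hlim : Tendsto (fun n : ℕ => 10 * (3 * C) / ((n:ℝ≥0∞) + 1)) atTop (𝓝 0) := by
      have h1 : Tendsto (fun n : ℕ => ((n:ℝ≥0∞) + 1)) atTop (𝓝 ∞) := by
        have := (tendsto_add_atTop_iff_nat 1).2 ENNReal.tendsto_nat_nhds_top
        simpa using this
      have := ENNReal.Tendsto.const_div h1 (a := 10 * (3 * C)) (Or.inr (by finiteness))
      simpa using this
    exact le_antisymm (ge_of_tendsto' hlim hle) zero_le
  exact hzero

theorem sqrt_bounds (w : ℂ) (hw : 0 < w.re) :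
    Complex.exp (Complex.log w / 2) ^ 2 = w ∧
    ‖Complex.exp (Complex.log w / 2)‖ ≤ 2 * (Complex.exp (Complex.log w / 2)).re := by
  have hw0 : w ≠ 0 := by rintro rfl; simp at hw
  refine ⟨?_, ?_⟩
  · rw [← Complex.exp_nat_mul]
    push_cast
    rw [mul_div_cancel₀ _ (by norm_num), Complex.exp_log hw0]
  · rw [Complex.norm_exp, Complex.exp_re]
    have hre : (Complex.log w / 2).im = Complex.arg w / 2 := by
      rw [show Complex.log w / 2 = ((1/2 : ℝ) : ℂ) * Complex.log w by push_cast; ring,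
        Complex.im_ofReal_mul, Complex.log_im]; ring
    rw [hre]
    have harg : |Complex.arg w| < π / 2 := Complex.abs_arg_lt_pi_div_two_iff.2 (Or.inl hw)
    have hcos : 1 / 2 ≤ Real.cos (Complex.arg w / 2) := by
      rw [← Real.cos_pi_div_three, ← Real.cos_abs (Complex.arg w / 2)]
      apply Real.cos_le_cos_of_nonneg_of_le_pi (abs_nonneg _) (by linarith [Real.pi_pos])
      rw [abs_div, abs_two]; linarith [Real.pi_pos]
    have := Real.exp_pos (Complex.log w / 2).re
    nlinarith

theorem maxRad_ae_lt_top_of_re_nonneg (H : ℂ → ℂ) (hH : DifferentiableOn ℂ H unitDisk)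
    (hre : ∀ z ∈ unitDisk, 0 ≤ (H z).re) :
    ∀ᵐ θ ∂(volume.restrict (Ioc 0 (2 * π))), maxRad H θ < ∞ := by
  set Q : ℂ → ℂ := fun z => Complex.exp (Complex.log (H z + 1) / 2) with hQ
  have hpos : ∀ z ∈ unitDisk, 0 < (H z + 1).re := by
    intro z hz; have := hre z hz; simp; linarith
  have hQd : DifferentiableOn ℂ Q unitDisk := by
    apply DifferentiableOn.cexp
    apply DifferentiableOn.div_const
    apply DifferentiableOn.clog (hH.add_const 1)
    intro z hz; exact Or.inl (hpos z hz)
  have hb : ∀ z ∈ unitDisk, ‖Q z‖ ≤ 2 * (Q z).re := fun z hz => (sqrt_bounds _ (hpos z hz)).2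
  have hmain := maxRad_ae_lt_top Q hQd (ENNReal.ofReal (2 * (2 * π * (Q 0).re))) (by finiteness) (by
    intro R hR
    have hcont : Continuous fun t : ℝ => Q (circlePt R t) :=
      hQd.continuousOn.comp_continuous (continuous_circlePt R)
        (fun t => circlePt_mem R t hR.1.le hR.2)
    have hmean : ∫ t in (0:ℝ)..(2 * π), Q (circlePt R t) = 2 * π * Q 0 := by
      have hd : DiffContOnCl ℂ Q (Metric.ball 0 |R|) := by
        apply DifferentiableOn.diffContOnCl
        rw [closure_ball _ (by simpa using hR.1.ne')]
        apply hQd.mono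
        intro z hz
        have : ‖z‖ ≤ |R| := by simpa using hz
        rw [abs_of_pos hR.1] at this
        simpa [unitDisk] using this.trans_lt hR.2
      have := hd.circleAverage
      rw [Real.circleAverage_def] at this
      have e : ∀ t, circleMap 0 R t = circlePt R t := fun t => by simp [circleMap, circlePt]
      simp only [e] at this
      rw [← this, Complex.real_smul]
      push_cast
      rw [mul_inv_cancel_left₀]
      have := Real.pi_pos.ne'
      simp [this]
    have hmre : ∫ t in (0:ℝ)..(2 * π), (Q (circlePt R t)).re = 2 * π * (Q 0).re := by
      have := congrArg Complex.re hmean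
      rw [← Complex.reCLM_apply, ← Complex.reCLM.intervalIntegral_comp_comm
        (hcont.intervalIntegrable _ _)] at this
      simpa using this
    calc ∫⁻ t in Ioc 0 (2 * π), ‖Q (circlePt R t)‖ₑ
        ≤ ∫⁻ t in Ioc 0 (2 * π), ENNReal.ofReal (2 * (Q (circlePt R t)).re) := by
          apply lintegral_mono
          intro t
          simp only []
          rw [← ofReal_norm]
          exact ENNReal.ofReal_le_ofReal (hb _ (circlePt_mem R t hR.1.le hR.2))
      _ = ENNReal.ofReal (∫ t in Ioc 0 (2 * π), 2 * (Q (circlePt R t)).re) := by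
          rw [ofReal_integral_eq_lintegral_ofReal]
          · apply Continuous.integrableOn_Ioc
            exact continuous_const.mul (Complex.continuous_re.comp hcont)
          · refine Eventually.of_forall fun t => ?_
            exact (norm_nonneg _).trans (hb _ (circlePt_mem R t hR.1.le hR.2))
      _ ≤ _ := by
          rw [← intervalIntegral.integral_of_le (by positivity),
            intervalIntegral.integral_const_mul, hmre])
  filter_upwards [hmain] with θ hθ
  have : maxRad H θ ≤ maxRad Q θ ^ 2 + 1 := by
    unfold maxRad
    refine iSup₂_le fun r hr => ?_
    have hz := circlePt_mem r θ hr.1 hr.2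
    have hle : (‖Q (circlePt r θ)‖₊ : ℝ≥0∞) ≤ maxRad Q θ := by
      unfold maxRad; exact le_iSup₂ (f := fun r _ => (‖Q (circlePt r θ)‖₊ : ℝ≥0∞)) r hr
    calc (‖H (circlePt r θ)‖₊ : ℝ≥0∞) ≤ (‖Q (circlePt r θ)‖₊ : ℝ≥0∞) ^ 2 + 1 := by
          have h1 : H (circlePt r θ) = Q (circlePt r θ) ^ 2 - 1 := by
            rw [hQ]; simp only []; rw [(sqrt_bounds _ (hpos _ hz)).1]; ring
          rw [h1]
          have : ‖Q (circlePt r θ) ^ 2 - 1‖₊ ≤ ‖Q (circlePt r θ)‖₊ ^ 2 + 1 := by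
            refine (nnnorm_sub_le _ _).trans ?_
            simp
          exact_mod_cast this
      _ ≤ _ := by gcongr; exact hle
  refine this.trans_lt ?_
  have := hθ.ne
  finiteness

theorem measurable_maxRad (f : ℂ → ℂ) (hf : ContinuousOn f unitDisk) : Measurable (maxRad f) := by
  have : LowerSemicontinuous (maxRad f) := by
    have h : ∀ r ∈ Ico (0:ℝ) 1, LowerSemicontinuous
        (fun θ => (‖f (circlePt r θ)‖₊ : ℝ≥0∞)) := by
      intro r hr
      apply Continuous.lowerSemicontinuous
      have := hf.comp_continuous (continuous_circlePt r)
        (fun t => circlePt_mem r t hr.1 hr.2)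
      exact ENNReal.continuous_coe.comp this.nnnorm
    exact lowerSemicontinuous_biSup h
  exact this.measurable

theorem le_maxRad (f : ℂ → ℂ) (r θ : ℝ) (h0 : 0 ≤ r) (h1 : r < 1) :
    (‖f (circlePt r θ)‖₊ : ℝ≥0∞) ≤ maxRad f θ := by
  unfold maxRad
  exact le_iSup₂ (f := fun r _ => (‖f (circlePt r θ)‖₊ : ℝ≥0∞)) r ⟨h0, h1⟩

theorem maxRad_le (f : ℂ → ℂ) (θ : ℝ) (c : ℝ≥0∞)
    (h : ∀ z ∈ unitDisk, (‖f z‖₊ : ℝ≥0∞) ≤ c) : maxRad f θ ≤ c := by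
  unfold maxRad
  exact iSup₂_le fun r hr => h _ (circlePt_mem r θ hr.1 hr.2)

theorem elogPlus_eq_zero (x : ℝ≥0∞) (hx : x ≤ 1) : elogPlus x = 0 := by
  unfold elogPlus
  have hne : x ≠ ∞ := (hx.trans_lt ENNReal.one_lt_top).ne
  rw [if_neg hne]
  apply ENNReal.ofReal_of_nonpos
  apply Real.log_nonpos ENNReal.toReal_nonneg
  exact ENNReal.toReal_le_of_le_ofReal zero_le_one (by simpa using hx)

theorem mp_of_bounded (p : ℝ) (hp : 0 < p) (f : ℂ → ℂ) (hf : DifferentiableOn ℂ f unitDisk)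
    (hb : ∀ z ∈ unitDisk, ‖f z‖ ≤ 1) : f ∈ MpClass p := by
  refine ⟨hf, ?_⟩
  have : ∀ θ, elogPlus (maxRad f θ) = 0 := fun θ => elogPlus_eq_zero _ <|
    maxRad_le f θ 1 fun z hz => by exact_mod_cast hb z hz
  simp [this, ENNReal.zero_rpow_of_pos hp]

theorem measurable_elogPlus : Measurable elogPlus := by
  unfold elogPlus
  refine Measurable.ite (measurableSet_singleton ∞) measurable_const ?_
  exact (Real.measurable_log.comp ENNReal.measurable_toReal).ennreal_ofReal

theorem measurable_elog1p : Measurable elog1p := by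
  unfold elog1p
  refine Measurable.ite (measurableSet_singleton ∞) measurable_const ?_
  exact (Real.measurable_log.comp (measurable_const.add ENNReal.measurable_toReal)).ennreal_ofReal

theorem elog1p_le (x : ℝ≥0∞) : elog1p x ≤ x := by
  unfold elog1p
  split_ifs with h
  · simp [h]
  · apply ENNReal.ofReal_le_of_le_toReal
    have := Real.log_le_sub_one_of_pos (x := 1 + x.toReal) (by positivity)
    linarith

theorem elog1p_two_mul (x y : ℝ≥0∞) (hy : y ≤ 2 * x) :
    elog1p y ≤ ENNReal.ofReal (Real.log 3) + elogPlus x := by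
  by_cases h : x = ∞
  · simp [elogPlus, h]
  have hy' : y ≠ ∞ := (hy.trans_lt (by finiteness)).ne
  unfold elog1p elogPlus
  rw [if_neg h, if_neg hy']
  have hr : y.toReal ≤ 2 * x.toReal := by
    have := ENNReal.toReal_mono (by finiteness) hy
    simpa using this
  have hx0 : 0 ≤ x.toReal := ENNReal.toReal_nonneg
  rcases le_total x.toReal 1 with h1 | h1
  · refine le_trans (ENNReal.ofReal_le_ofReal ?_) le_self_add
    apply Real.log_le_log (by positivity)
    linarith
  · rw [← ENNReal.ofReal_add (Real.log_nonneg (by norm_num)) (Real.log_nonneg h1)]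
    apply ENNReal.ofReal_le_ofReal
    rw [← Real.log_mul (by norm_num) (by linarith)]
    apply Real.log_le_log (by positivity)
    linarith

theorem elogPlus_lt_top_imp (x : ℝ≥0∞) (h : elogPlus x < ∞) : x < ∞ := by
  by_contra hx
  simp at hx
  simp [elogPlus, hx] at h

theorem lintegral_of_mp (p : ℝ) (φ : ℂ → ℂ) (h : φ ∈ MpClass p) :
    ∫⁻ θ in Ioc 0 (2 * π), elogPlus (maxRad φ θ) ^ p ≠ ∞ := by
  intro h'
  have := h.2
  rw [h', ENNReal.top_div_of_ne_top (by finiteness)] at this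
  exact lt_irrefl _ this

theorem maxRad_ae_lt_top_of_mp (p : ℝ) (hp : 0 < p) (φ : ℂ → ℂ) (h : φ ∈ MpClass p) :
    ∀ᵐ θ ∂(volume.restrict (Ioc 0 (2*π))), maxRad φ θ < ∞ := by
  have hm := (measurable_elogPlus.comp (measurable_maxRad φ h.1.continuousOn)).pow_const p
  have := ae_lt_top' hm.aemeasurable (lintegral_of_mp p φ h)
  filter_upwards [this] with θ hθ
  apply elogPlus_lt_top_imp
  exact (ENNReal.rpow_lt_top_iff_of_pos hp).1 hθ

theorem exp_bound (w : ℂ) (hw : 0 ≤ w.re) : ‖1 - Complex.exp (-w)‖ ≤ ‖w‖ := by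
  have h : Convex ℝ {z : ℂ | 0 ≤ z.re} := convex_halfSpace_re_ge 0
  have := h.norm_image_sub_le_of_norm_hasDerivWithin_le (f := fun z => Complex.exp (-z))
    (f' := fun z => -Complex.exp (-z)) (C := 1) (x := w) (y := 0) ?_ ?_ hw ?_
  · simpa using this
  · intro z _
    have := ((hasDerivAt_id z).neg.cexp).hasDerivWithinAt (s := {z : ℂ | 0 ≤ z.re})
    simpa using this
  · intro z hz
    rw [norm_neg, Complex.norm_exp]
    simpa using hz
  · simp

theorem stepC (p : ℝ) (hp : 1 < p) (I : Set (ℂ → ℂ)) (hI : IsPrimeIdealIn p I)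
    (hext : ∀ f ∈ I, ∀ g ∈ MpClass p, EqOn f g unitDisk → g ∈ I)
    (g : ℂ → ℂ) (hg : g ∈ I) (H : ℂ → ℂ) (hH : DifferentiableOn ℂ H unitDisk)
    (hre : ∀ z ∈ unitDisk, 0 ≤ (H z).re)
    (hgH : ∀ z ∈ unitDisk, g z = Complex.exp (-H z)) : IsDenseIn p I := by
  have hp0 : 0 < p := by linarith
  set G : ℕ → ℂ → ℂ := fun n z => Complex.exp (-(H z / (n + 1))) with hG
  have hre' : ∀ n : ℕ, ∀ z ∈ unitDisk, 0 ≤ (H z / ((n : ℂ) + 1)).re := by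
    intro n z hz
    have : (H z / ((n : ℂ) + 1)).re = (H z).re / (n + 1) := by
      have := Complex.div_ofReal_re (H z) ((n:ℝ) + 1)
      push_cast at this
      exact this
    rw [this]
    have := hre z hz
    positivity
  have hGb : ∀ n, ∀ z ∈ unitDisk, ‖G n z‖ ≤ 1 := by
    intro n z hz
    simp only [hG]
    rw [Complex.norm_exp, Real.exp_le_one_iff, Complex.neg_re]
    have := hre' n z hz
    linarith
  have hGd : ∀ n, DifferentiableOn ℂ (G n) unitDisk := fun n => ((hH.div_const _).neg).cexp
  have hGp : ∀ n k, (G n) ^ k ∈ MpClass p := by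
    intro n k
    refine mp_of_bounded p hp0 _ ((hGd n).pow k) fun z hz => ?_
    simp only [Pi.pow_apply, norm_pow]
    exact pow_le_one₀ (norm_nonneg _) (hGb n z hz)
  have hGn : ∀ n, G n ∈ MpClass p := fun n => by simpa using hGp n 1
  have hGI : ∀ n, G n ∈ I := by
    intro n
    have h1 : (G n) ^ (n + 1) ∈ I := by
      refine hext g hg _ (hGp n _) fun z hz => ?_
      rw [hgH z hz]
      simp only [hG, Pi.pow_apply, ← Complex.exp_nat_mul]
      congr 1
      have : (n : ℂ) + 1 ≠ 0 := by exact_mod_cast Nat.succ_ne_zero n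
      push_cast
      field_simp
    have h2 : ∀ k, (G n) ^ (k + 1) ∈ I → G n ∈ I := by
      intro k
      induction k with
      | zero => simp
      | succ k ih =>
        intro h
        rw [pow_succ] at h
        rcases hI.2 _ (hGp n (k+1)) _ (hGn n) h with h | h
        · exact ih h
        · exact h
    exact h2 n h1
  intro φ hφ ε hε
  have hmem : ∀ n, φ * G n ∈ I := fun n => hI.1.mul_mem φ hφ _ (hGI n)
  have key : Tendsto (fun n => ∫⁻ θ in Ioc 0 (2 * π), elog1p (maxRad (φ - φ * G n) θ) ^ p)
      atTop (𝓝 (∫⁻ θ in Ioc 0 (2 * π), 0)) := by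
    have hdiff : ∀ n z, z ∈ unitDisk → ‖(φ - φ * G n) z‖ = ‖φ z‖ * ‖1 - G n z‖ := by
      intro n z _
      rw [← norm_mul]; congr 1; simp; ring
    apply tendsto_lintegral_of_dominated_convergence'
      (fun θ => (2:ℝ≥0∞) ^ (p - 1) * ((ENNReal.ofReal (Real.log 3)) ^ p + elogPlus (maxRad φ θ) ^ p))
    · intro n
      have hc : ContinuousOn (φ - φ * G n) unitDisk :=
        (hφ.1.sub (hφ.1.mul (hGd n))).continuousOn
      exact ((measurable_elog1p.comp (measurable_maxRad _ hc)).pow_const p).aemeasurable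
    · intro n
      refine Eventually.of_forall fun θ => ?_
      refine le_trans ?_ (ENNReal.rpow_add_le_mul_rpow_add_rpow _ _ hp.le)
      refine ENNReal.rpow_le_rpow (elog1p_two_mul _ _ ?_) hp0.le
      conv_lhs => unfold maxRad
      refine iSup₂_le fun r hr => ?_
      have hz := circlePt_mem r θ hr.1 hr.2
      have h1 := le_maxRad φ r θ hr.1 hr.2
      refine le_trans ?_ (mul_le_mul_right h1 2)
      have : ‖(φ - φ * G n) (circlePt r θ)‖ ≤ 2 * ‖φ (circlePt r θ)‖ := by
        rw [hdiff n _ hz, mul_comm]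
        gcongr
        refine (norm_sub_le _ _).trans ?_
        have := hGb n _ hz
        rw [norm_one]; linarith
      exact_mod_cast this
    · rw [lintegral_const_mul', lintegral_add_left measurable_const]
      · have := lintegral_of_mp p φ hφ
        simp only [lintegral_const, Measure.restrict_apply, MeasurableSet.univ, univ_inter,
          Real.volume_Ioc]
        have h2 : ENNReal.ofReal (Real.log 3) ^ p ≠ ∞ :=
          ENNReal.rpow_ne_top_of_nonneg hp0.le (by finiteness)
        have h3 : (2:ℝ≥0∞) ^ (p-1) ≠ ∞ :=
          ENNReal.rpow_ne_top_of_nonneg (by linarith) (by finiteness)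
        finiteness
      · exact ENNReal.rpow_ne_top_of_nonneg (by linarith) (by finiteness)
    · filter_upwards [maxRad_ae_lt_top_of_re_nonneg H hH hre, maxRad_ae_lt_top_of_mp p hp0 φ hφ]
        with θ h1 h2
      have hb : ∀ n : ℕ, elog1p (maxRad (φ - φ * G n) θ) ≤
          (maxRad φ θ * maxRad H θ) * ((n + 1 : ℕ) : ℝ≥0∞)⁻¹ := by
        intro n
        refine (elog1p_le _).trans ?_
        conv_lhs => unfold maxRad
        refine iSup₂_le fun r hr => ?_
        have hz := circlePt_mem r θ hr.1 hr.2
        have hφ1 := le_maxRad φ r θ hr.1 hr.2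
        have hH1 := le_maxRad H r θ hr.1 hr.2
        refine le_trans ?_ (mul_le_mul_left (mul_le_mul' hφ1 hH1) _)
        have : ‖(φ - φ * G n) (circlePt r θ)‖₊ ≤
            ‖φ (circlePt r θ)‖₊ * ‖H (circlePt r θ)‖₊ * ((n + 1 : ℕ) : ℝ≥0)⁻¹ := by
          rw [← NNReal.coe_le_coe]
          push_cast
          rw [hdiff n _ hz, mul_assoc]
          gcongr
          refine (exp_bound _ (hre' n _ hz)).trans ?_
          rw [norm_div, div_eq_mul_inv]
          have : ‖(n:ℂ) + 1‖ = n + 1 := by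
            have := Complex.norm_natCast (n+1)
            push_cast at this; exact this
          rw [this]
        have h3 : (((n + 1 : ℕ) : ℝ≥0∞))⁻¹ = ((((n + 1 : ℕ) : ℝ≥0)⁻¹ : ℝ≥0) : ℝ≥0∞) := by
          rw [ENNReal.coe_inv (by positivity)]; simp
        rw [h3]
        exact_mod_cast this
      have ht : Tendsto (fun n : ℕ => ((maxRad φ θ * maxRad H θ) * ((n + 1 : ℕ) : ℝ≥0∞)⁻¹) ^ p)
          atTop (𝓝 0) := by
        have h4 := ENNReal.tendsto_inv_nat_nhds_zero.comp (tendsto_add_atTop_nat 1)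
        have h5 := ENNReal.Tendsto.const_mul (a := maxRad φ θ * maxRad H θ) h4
          (Or.inr (by finiteness))
        have h6 := h5.ennrpow_const p
        simpa [ENNReal.zero_rpow_of_pos hp0] using h6
      refine tendsto_of_tendsto_of_tendsto_of_le_of_le tendsto_const_nhds ht (fun n => zero_le) ?_
      intro n
      exact ENNReal.rpow_le_rpow (hb n) hp0.le
  have hrho : Tendsto (fun n => rhoMetric p φ (φ * G n)) atTop (𝓝 0) := by
    have h1 := ENNReal.Tendsto.div_const key (b := ENNReal.ofReal (2 * π)) (Or.inr (by
      have := Real.pi_pos; simpa using this))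
    have h2 := h1.ennrpow_const (1 / p)
    simpa [rhoMetric, ENNReal.zero_rpow_of_pos (inv_pos.2 hp0)] using h2
  obtain ⟨n, hn⟩ := ((tendsto_order.1 hrho).2 ε hε).exists
  exact ⟨_, hmem n, hn⟩

theorem trig_span (P : C(AddCircle (2 * π), ℂ))
    (hP : P ∈ Submodule.span ℂ (range (@fourier (2 * π)))) :
    ∀ c : ℂ, ∃ q : ℂ → ℂ, Differentiable ℂ q ∧
      ∀ θ : ℝ, (c * P (θ : AddCircle (2 * π))).re = (q (Complex.exp (θ * Complex.I))).re := by
  induction hP using Submodule.span_induction with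
  | mem x h =>
    obtain ⟨n, rfl⟩ := h
    intro c
    have hf : ∀ θ : ℝ, fourier n (θ : AddCircle (2 * π)) = Complex.exp (n * (θ * Complex.I)) := by
      intro θ
      rw [fourier_coe_apply]
      congr 1
      have : (π : ℂ) ≠ 0 := by exact_mod_cast Real.pi_ne_zero
      push_cast
      field_simp
    obtain ⟨m, rfl | rfl⟩ := n.eq_nat_or_neg
    · refine ⟨fun z => c * z ^ m, by fun_prop, fun θ => ?_⟩
      rw [hf]
      simp only [← Complex.exp_nat_mul]
      push_cast; rfl
    · refine ⟨fun z => (starRingEnd ℂ) c * z ^ m, by fun_prop, fun θ => ?_⟩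
      rw [hf]
      simp only [← Complex.exp_nat_mul]
      rw [← Complex.conj_re (c * _), map_mul, ← Complex.exp_conj]
      simp
  | zero => exact fun c => ⟨0, by fun_prop, by simp⟩
  | add x y _ _ hx hy =>
    intro c
    obtain ⟨q1, h1, h1'⟩ := hx c
    obtain ⟨q2, h2, h2'⟩ := hy c
    refine ⟨q1 + q2, h1.add h2, fun θ => ?_⟩
    simp only [ContinuousMap.add_apply, mul_add, Complex.add_re, h1', h2', Pi.add_apply]
  | smul a x _ hx =>
    intro c
    obtain ⟨q1, h1, h1'⟩ := hx (c * a)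
    refine ⟨q1, h1, fun θ => ?_⟩
    rw [← h1']
    simp [mul_assoc]

theorem trig_approx (φ : ℂ → ℝ) (hφ : ContinuousOn φ (Metric.sphere 0 1)) (ε : ℝ) (hε : 0 < ε) :
    ∃ q : ℂ → ℂ, Differentiable ℂ q ∧
      ∀ θ : ℝ, φ (Complex.exp (θ * Complex.I)) ≤ (q (Complex.exp (θ * Complex.I))).re ∧
        (q (Complex.exp (θ * Complex.I))).re ≤ φ (Complex.exp (θ * Complex.I)) + ε := by
  have : Fact (0 < 2 * π) := ⟨by positivity⟩
  let F : C(AddCircle (2 * π), ℂ) :=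
    ⟨fun x => ((φ (AddCircle.toCircle x : ℂ) : ℝ) : ℂ), by
      refine Complex.continuous_ofReal.comp (hφ.comp_continuous ?_ ?_)
      · exact continuous_subtype_val.comp AddCircle.continuous_toCircle
      · intro x; simpa using Circle.norm_coe _⟩
  have hF : F ∈ (Submodule.span ℂ (range (@fourier (2 * π)))).topologicalClosure := by
    rw [span_fourier_closure_eq_top]; trivial
  have hF' : F ∈ closure ((Submodule.span ℂ (range (@fourier (2 * π))) : Set C(AddCircle (2 * π), ℂ))) := hF
  obtain ⟨P, hP, hd⟩ := Metric.mem_closure_iff.1 hF' (ε / 2) (by positivity)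
  obtain ⟨q, hq, hq'⟩ := trig_span P hP 1
  refine ⟨fun z => q z + (ε / 2 : ℝ), by fun_prop, fun θ => ?_⟩
  have h1 : dist (F (θ : AddCircle (2 * π))) (P θ) < ε / 2 :=
    (ContinuousMap.dist_apply_le_dist _).trans_lt hd
  have h2 : F (θ : AddCircle (2 * π)) = (φ (Complex.exp (θ * Complex.I)) : ℂ) := by
    have : ((AddCircle.toCircle (θ : AddCircle (2 * π)) : Circle) : ℂ)
        = Complex.exp (θ * Complex.I) := by
      rw [AddCircle.toCircle_apply_mk, Circle.coe_exp]
      congr 3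
      have := Real.pi_ne_zero
      field_simp
    change ((φ (AddCircle.toCircle (θ : AddCircle (2 * π)) : ℂ) : ℝ) : ℂ) = _
    rw [this]
  rw [h2, dist_eq_norm] at h1
  have h3 := (Complex.abs_re_le_norm _).trans h1.le
  rw [Complex.sub_re, Complex.ofReal_re] at h3
  have h4 := hq' θ
  rw [one_mul] at h4
  rw [h4, abs_le] at h3
  simp only [Complex.add_re, Complex.ofReal_re]
  constructor <;> linarith

theorem poisson_major (f : ℂ → ℂ) (hf : DifferentiableOn ℂ f unitDisk) (U : ℂ → ℝ)
    (hU : CircleIntegrable U 0 1)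
    (hUf : ∀ᵐ θ ∂(volume.restrict (Ioc 0 (2*π))), ∀ r ∈ Ico (0:ℝ) 1,
      Real.log (max 1 ‖f (circlePt r θ)‖) ≤ U (circleMap 0 1 θ))
    (w : ℂ) (hw : w ∈ unitDisk) :
    ‖f w‖ ≤ Real.exp (Real.circleAverage ((Complex.re ∘ herglotzRieszKernel 0 w) • U) 0 1) := by
  set A := Real.circleAverage ((Complex.re ∘ herglotzRieszKernel 0 w) • U) 0 1 with hA
  have hw1 : ‖w‖ < 1 := by simpa [unitDisk] using hw
  have hRball : ∀ R ∈ Ico (0:ℝ) 1, ∀ z : ℂ, ‖z‖ ≤ 1 → (R:ℂ) * z ∈ unitDisk := by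
    intro R hR z hz
    have : ‖(R:ℂ) * z‖ < 1 := by
      rw [norm_mul, Complex.norm_real, Real.norm_of_nonneg hR.1]
      calc R * ‖z‖ ≤ R * 1 := by gcongr; exact hR.1
        _ < 1 := by linarith [hR.2]
    simpa [unitDisk] using this
  have hR : ∀ R ∈ Ico (0:ℝ) 1, ‖f (R * w)‖ ≤ Real.exp A := by
    intro R hR
    have hfR : DifferentiableOn ℂ (fun z : ℂ => f (R * z)) (Metric.closedBall 0 1) := by
      apply hf.comp (by fun_prop)
      intro z hz
      exact hRball R hR z (by simpa using hz)
    have hε : ∀ ε > 0, ‖f (R * w)‖ ≤ Real.exp (A + ε) := by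
      intro ε hε
      obtain ⟨q, hq, hqb⟩ := trig_approx (fun z => Real.log (max 1 ‖f (R * z)‖)) (by
        apply ContinuousOn.log
        · apply continuousOn_const.sup
          exact (hfR.continuousOn.mono Metric.sphere_subset_closedBall).norm
        · intro z _
          have := le_max_left 1 ‖f (R * z)‖
          positivity) ε hε
      have hmax : ‖f (R * w) * Complex.exp (-q w)‖ ≤ 1 := by
        have hd : DifferentiableOn ℂ (fun z : ℂ => f (R * z) * Complex.exp (-q z))
            (Metric.closedBall 0 1) := hfR.mul (by fun_prop)
        refine Complex.norm_le_of_forall_mem_frontier_norm_le (U := Metric.ball 0 1)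
          (f := fun z : ℂ => f (R * z) * Complex.exp (-q z)) Metric.isBounded_ball ?_ ?_
          (subset_closure hw)
        · apply DifferentiableOn.diffContOnCl
          rwa [closure_ball _ one_ne_zero]
        · intro z hz
          rw [frontier_ball _ one_ne_zero] at hz
          have hz1 : ‖z‖ = 1 := by simpa using hz
          have hzθ : z = Complex.exp (z.arg * Complex.I) := by
            have := Complex.norm_mul_exp_arg_mul_I z
            rw [hz1] at this; simpa using this.symm
          have h1 := (hqb z.arg).1
          rw [← hzθ] at h1
          rw [norm_mul, Complex.norm_exp, Complex.neg_re, Real.exp_neg]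
          rw [← div_eq_mul_inv, div_le_one (Real.exp_pos _)]
          refine (le_max_right 1 _).trans ?_
          rwa [← Real.log_le_iff_le_exp (by positivity)]
      have hq1 : ‖f (R * w)‖ ≤ Real.exp (q w).re := by
        rwa [norm_mul, Complex.norm_exp, Complex.neg_re, Real.exp_neg, ← div_eq_mul_inv,
          div_le_one (Real.exp_pos _)] at hmax
      refine hq1.trans (Real.exp_le_exp.2 ?_)
      have hqd : Differentiable ℂ (fun z => q z - ε) := by fun_prop
      have hP := (hqd.diffContOnCl (s := Metric.ball 0 1)).circleAverage_re_herglotzRieszKernel_smul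
        (w := w) hw
      have hKc : Continuous (fun θ => (herglotzRieszKernel 0 w (circleMap 0 1 θ)).re) := by
        refine Complex.continuous_re.comp
          ((continuousOn_herglotzRieszKernel_sphere (R := 1) hw).comp_continuous
            (continuous_circleMap 0 1) fun θ => ?_)
        simp
      have hP' : (2 * π)⁻¹ * ∫ θ in (0:ℝ)..(2 * π), (herglotzRieszKernel 0 w (circleMap 0 1 θ)).re *
          (q (circleMap 0 1 θ) - ε).re = (q w).re - ε := by
        have := congrArg Complex.re hP
        rw [Real.circleAverage_def, Complex.smul_re, ← Complex.reCLM_apply,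
          ← Complex.reCLM.intervalIntegral_comp_comm] at this
        · simpa using this
        · apply Continuous.intervalIntegrable
          simp only [Pi.smul_apply', Function.comp_apply]
          exact hKc.smul (hqd.continuous.comp (continuous_circleMap 0 1))
      have : (q w).re - ε ≤ A := by
        rw [← hP', hA, Real.circleAverage_def, smul_eq_mul]
        gcongr
        apply intervalIntegral.integral_mono_ae_restrict (by positivity)
        · apply Continuous.intervalIntegrable
          exact hKc.mul (Complex.continuous_re.comp
            (hqd.continuous.comp (continuous_circleMap 0 1)))
        · have : IntervalIntegrable (fun θ => U (circleMap 0 1 θ)) volume 0 (2 * π) := hU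
          exact this.continuousOn_mul hKc.continuousOn
        · have : (Icc 0 (2 * π) : Set ℝ) =ᵐ[volume] Ioc 0 (2 * π) := Ioc_ae_eq_Icc.symm
          rw [Measure.restrict_congr_set this]
          filter_upwards [hUf] with θ hθ
          have h1 := hθ R hR
          have h2 := (hqb θ).2
          have e : circleMap 0 1 θ = Complex.exp (θ * Complex.I) := by simp [circleMap]
          rw [← e] at h2
          have e2 : circlePt R θ = R * circleMap 0 1 θ := circlePt_eq R θ
          rw [e2] at h1
          simp only [Pi.smul_apply', Function.comp_apply, smul_eq_mul]
          refine mul_le_mul_of_nonneg_left ?_ ?_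
          · simp only [Complex.sub_re, Complex.ofReal_re]
            linarith
          · have := le_re_herglotzRieszKernel (c := 0) (R := 1) (z := circleMap 0 1 θ) (w := w)
              (by simp) hw
            refine le_trans ?_ this
            have h5 : ‖w - 0‖ < 1 := by simpa using hw1
            have := norm_nonneg (w - 0)
            apply div_nonneg <;> linarith
      linarith
    have : Tendsto (fun ε : ℝ => Real.exp (A + ε)) (𝓝[>] 0) (𝓝 (Real.exp (A + 0))) := by
      apply Tendsto.mono_left _ nhdsWithin_le_nhds
      have : Continuous (fun ε : ℝ => Real.exp (A + ε)) := by fun_prop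
      exact this.tendsto 0
    rw [add_zero] at this
    exact ge_of_tendsto this (eventually_mem_nhdsWithin.mono fun ε hε' => hε ε hε')
  have hlim : Tendsto (fun R : ℝ => ‖f (R * w)‖) (𝓝[<] 1) (𝓝 ‖f w‖) := by
    have hc : ContinuousAt f ((1:ℝ) * w) := by
      rw [Complex.ofReal_one, one_mul]
      exact (hf.differentiableAt (Metric.isOpen_ball.mem_nhds hw)).continuousAt
    have hc2 : ContinuousAt (fun R : ℝ => f (R * w)) 1 :=
      ContinuousAt.comp (f := fun R : ℝ => (R:ℂ) * w) hc (by fun_prop)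
    have := hc2.norm.tendsto
    simp only [Complex.ofReal_one, one_mul] at this
    exact this.mono_left nhdsWithin_le_nhds
  refine le_of_tendsto hlim ?_
  filter_upwards [Ioo_mem_nhdsLT (zero_lt_one' ℝ)] with R h
  exact hR R ⟨h.1.le, h.2⟩

theorem stepA (p : ℝ) (hp : 1 < p) (f : ℂ → ℂ) (hf : f ∈ MpClass p) :
    ∃ W : ℂ → ℂ, DifferentiableOn ℂ W unitDisk ∧ (∀ z ∈ unitDisk, 0 ≤ (W z).re) ∧
      ∀ z ∈ unitDisk, ‖f z‖ ≤ Real.exp (W z).re := by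
  have hp0 : 0 < p := by linarith
  set U : ℂ → ℝ := fun ζ => (elogPlus (⨆ r ∈ Ico (0:ℝ) 1, (‖f (r * ζ)‖₊ : ℝ≥0∞))).toReal with hUdef
  have hUc : ∀ θ, U (circleMap 0 1 θ) = (elogPlus (maxRad f θ)).toReal := by
    intro θ
    simp only [hUdef, maxRad, circlePt_eq]
  have hUint : CircleIntegrable U 0 1 := by
    unfold CircleIntegrable
    simp only [hUc]
    rw [intervalIntegrable_iff_integrableOn_Ioc_of_le (by positivity)]
    apply integrable_toReal_of_lintegral_ne_top
    · exact (measurable_elogPlus.comp (measurable_maxRad f hf.1.continuousOn)).aemeasurable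
    · have h1 : ∀ x : ℝ≥0∞, x ≤ 1 + x ^ p := by
        intro x
        rcases le_total x 1 with h | h
        · exact h.trans le_self_add
        · refine le_trans ?_ le_add_self
          conv_lhs => rw [← ENNReal.rpow_one x]
          exact ENNReal.rpow_le_rpow_of_exponent_le h hp.le
      refine ((lintegral_mono fun θ => h1 _).trans_lt ?_).ne
      rw [lintegral_add_left measurable_const]
      have := lintegral_of_mp p f hf
      simp only [lintegral_const, Measure.restrict_apply, MeasurableSet.univ, univ_inter,
          Real.volume_Ioc]
      finiteness
  refine ⟨fun w => Real.circleAverage (fun ζ ↦ herglotzRieszKernel 0 w ζ • ((U ζ : ℝ) : ℂ)) 0 1,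
    ?_, ?_, ?_⟩
  · apply differentiableOn_circleAverage_herglotzRieszKernel_smul
    simp only [CircleIntegrable, intervalIntegrable_iff] at hUint ⊢
    exact Complex.ofRealCLM.integrable_comp hUint
  · intro w hw
    rw [re_circleAverage_herglotzRieszKernel_smul hUint hw]
    rw [Real.circleAverage_def, smul_eq_mul]
    refine mul_nonneg (by positivity) ?_
    apply intervalIntegral.integral_nonneg (by positivity)
    intro θ _
    simp only [Pi.smul_apply', Function.comp_apply, smul_eq_mul, hUc]
    refine mul_nonneg ?_ ENNReal.toReal_nonneg
    have := le_re_herglotzRieszKernel (c := 0) (R := 1) (z := circleMap 0 1 θ) (w := w)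
              (by simp) hw
    refine le_trans ?_ this
    have h5 : ‖w - 0‖ < 1 := by simpa [unitDisk] using hw
    have := norm_nonneg (w - 0)
    apply div_nonneg <;> linarith
  · intro w hw
    rw [re_circleAverage_herglotzRieszKernel_smul hUint hw]
    apply poisson_major f hf.1 U hUint _ w hw
    filter_upwards [maxRad_ae_lt_top_of_mp p hp0 f hf] with θ hθ r hr
    rw [hUc]
    unfold elogPlus
    rw [if_neg hθ.ne, ENNReal.toReal_ofReal']
    have h1 := le_maxRad f r θ hr.1 hr.2
    have h2 : ‖f (circlePt r θ)‖ ≤ (maxRad f θ).toReal := by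
      have := ENNReal.toReal_mono hθ.ne h1
      simpa using this
    rcases le_total ‖f (circlePt r θ)‖ 1 with h | h
    · rw [max_eq_left h]; simp
    · rw [max_eq_right h]
      exact (Real.log_le_log (by linarith) h2).trans (le_max_left _ _)

theorem mem_unitDisk {z : ℂ} : z ∈ unitDisk ↔ ‖z‖ < 1 := by simp [unitDisk]

theorem isOpen_unitDisk : IsOpen unitDisk := Metric.isOpen_ball

theorem norm_conj_mul_lt {a z : ℂ} (ha : ‖a‖ < 1) (hz : ‖z‖ < 1) :
    ‖(starRingEnd ℂ) a * z‖ < 1 := by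
  rw [norm_mul, RCLike.norm_conj]
  nlinarith [norm_nonneg a, norm_nonneg z]

theorem bl_den_ne {a z : ℂ} (ha : ‖a‖ < 1) (hz : ‖z‖ < 1) :
    1 - (starRingEnd ℂ) a * z ≠ 0 := by
  intro h
  have := norm_conj_mul_lt ha hz
  rw [← sub_eq_zero.1 h] at this
  simp at this

theorem moebius_norm_lt {a z : ℂ} (ha : ‖a‖ < 1) (hz : ‖z‖ < 1) :
    ‖(a - z) / (1 - (starRingEnd ℂ) a * z)‖ < 1 := by
  have h0 := bl_den_ne ha hz
  rw [norm_div, div_lt_one (norm_pos_iff.2 h0)]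
  have key : ‖1 - (starRingEnd ℂ) a * z‖ ^ 2 - ‖a - z‖ ^ 2 = (1 - ‖a‖ ^ 2) * (1 - ‖z‖ ^ 2) := by
    simp only [Complex.sq_norm, Complex.normSq_apply]
    simp
    ring
  have h1 : 0 < (1 - ‖a‖ ^ 2) * (1 - ‖z‖ ^ 2) := by
    apply mul_pos <;> nlinarith [norm_nonneg a, norm_nonneg z]
  exact lt_of_pow_lt_pow_left₀ 2 (norm_nonneg _) (by linarith)

theorem moebius_invol {a z : ℂ} (ha : ‖a‖ < 1) (hz : ‖z‖ < 1) :
    (a - (a - z) / (1 - (starRingEnd ℂ) a * z)) /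
      (1 - (starRingEnd ℂ) a * ((a - z) / (1 - (starRingEnd ℂ) a * z))) = z := by
  have h0 := bl_den_ne ha hz
  have h1 := bl_den_ne ha ha
  have h2 := bl_den_ne ha (moebius_norm_lt ha hz)
  rw [div_eq_iff h2]
  generalize (starRingEnd ℂ) a = c at *
  have e : (1 - c * z) * ((a - z) / (1 - c * z)) = a - z := mul_div_cancel₀ _ h0
  generalize (a - z) / (1 - c * z) = q at *
  linear_combination -e

theorem norm_blaschke {a : ℂ} (ha : a ≠ 0) (z : ℂ) :
    ‖blaschkeFactor a z‖ = ‖(a - z) / (1 - (starRingEnd ℂ) a * z)‖ := by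
  unfold blaschkeFactor
  rw [norm_mul]
  have : ‖(‖a‖ : ℂ) / a‖ = 1 := by
    rw [norm_div, Complex.norm_real, norm_norm, div_self (norm_ne_zero_iff.2 ha)]
  rw [this, one_mul]

theorem norm_blaschke_le {a z : ℂ} (ha0 : a ≠ 0) (ha : ‖a‖ < 1) (hz : ‖z‖ < 1) :
    ‖blaschkeFactor a z‖ ≤ 1 := by
  rw [norm_blaschke ha0]; exact (moebius_norm_lt ha hz).le

theorem blaschke_ne {a z : ℂ} (ha0 : a ≠ 0) (ha : ‖a‖ < 1) (hz : ‖z‖ < 1) (hne : z ≠ a) :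
    blaschkeFactor a z ≠ 0 := by
  rw [← norm_ne_zero_iff, norm_blaschke ha0, norm_ne_zero_iff]
  exact div_ne_zero (sub_ne_zero.2 hne.symm) (bl_den_ne ha hz)

theorem blaschke_diff {a : ℂ} (ha : ‖a‖ < 1) :
    DifferentiableOn ℂ (blaschkeFactor a) unitDisk := by
  unfold blaschkeFactor
  intro z hz
  have := bl_den_ne ha (mem_unitDisk.1 hz)
  apply DifferentiableAt.differentiableWithinAt
  fun_prop (disch := assumption)

theorem blaschke_sub_one {a z : ℂ} (ha0 : a ≠ 0) (ha : ‖a‖ < 1) (hz : ‖z‖ < 1) :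
    ‖blaschkeFactor a z - 1‖ ≤ 2 / (1 - ‖z‖) * (1 - ‖a‖) := by
  have h0 := bl_den_ne ha hz
  have hc : (starRingEnd ℂ) a * a = (‖a‖ : ℂ) ^ 2 := Complex.conj_mul' a
  have e : blaschkeFactor a z - 1 =
      -(((1 - ‖a‖ : ℝ) : ℂ) * ((a + ‖a‖ * z) / (a * (1 - (starRingEnd ℂ) a * z)))) := by
    unfold blaschkeFactor
    generalize (starRingEnd ℂ) a = c at *
    have h0' : 1 - z * c ≠ 0 := by rwa [mul_comm]
    field_simp
    push_cast
    linear_combination z * hc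
  rw [e, norm_neg, norm_mul, Complex.norm_real, Real.norm_of_nonneg (by linarith), mul_comm]
  refine mul_le_mul_of_nonneg_right ?_ (by linarith)
  rw [norm_div, norm_mul]
  have hapos := norm_pos_iff.2 ha0
  have h1 : ‖a + ‖a‖ * z‖ ≤ 2 * ‖a‖ := by
    refine (norm_add_le _ _).trans ?_
    rw [norm_mul, Complex.norm_real, norm_norm]
    nlinarith
  have h2 : 1 - ‖z‖ ≤ ‖1 - (starRingEnd ℂ) a * z‖ := by
    have := norm_sub_norm_le (1:ℂ) ((starRingEnd ℂ) a * z)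
    rw [norm_one, norm_mul, RCLike.norm_conj] at this
    nlinarith [norm_nonneg z]
  rw [div_le_div_iff₀ (by nlinarith [norm_pos_iff.2 h0]) (by linarith)]
  have h3 : 0 ≤ 1 - ‖z‖ := by linarith
  calc ‖a + ‖a‖ * z‖ * (1 - ‖z‖) ≤ (2 * ‖a‖) * ‖1 - (starRingEnd ℂ) a * z‖ := by gcongr
    _ = _ := by ring

theorem schwarz_pick {f : ℂ → ℂ} (hf : DifferentiableOn ℂ f unitDisk)
    (hb : ∀ z ∈ unitDisk, ‖f z‖ ≤ 1) {a : ℂ} (ha : ‖a‖ < 1) (hfa : f a = 0) {z : ℂ}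
    (hz : ‖z‖ < 1) : ‖f z‖ ≤ ‖(a - z) / (1 - (starRingEnd ℂ) a * z)‖ := by
  have := Complex.norm_le_norm_of_mapsTo_ball (R := 1)
    (f := fun w => f ((a - w) / (1 - (starRingEnd ℂ) a * w)))
    (z := (a - z) / (1 - (starRingEnd ℂ) a * z)) ?_ ?_ ?_ (moebius_norm_lt ha hz)
  · simpa only [moebius_invol ha hz] using this
  · apply hf.comp
    · intro w hw
      have := bl_den_ne ha (mem_unitDisk.1 hw)
      apply DifferentiableAt.differentiableWithinAt
      fun_prop (disch := assumption)
    · intro w hw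
      exact mem_unitDisk.2 (moebius_norm_lt ha (mem_unitDisk.1 hw))
  · intro w hw
    simpa using hb _ (mem_unitDisk.2 (moebius_norm_lt ha (mem_unitDisk.1 hw)))
  · simpa using hfa

theorem dslope_factor {f : ℂ → ℂ} (hf : DifferentiableOn ℂ f unitDisk) {a : ℂ} (ha : ‖a‖ < 1)
    (hfa : f a = 0) : DifferentiableOn ℂ (dslope f a) unitDisk ∧
      ∀ z, f z = (z - a) * dslope f a z := by
  constructor
  · exact (Complex.differentiableOn_dslope (isOpen_unitDisk.mem_nhds (mem_unitDisk.2 ha))).2 hf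
  · intro z
    have := sub_smul_dslope f a z
    rw [smul_eq_mul, hfa, sub_zero] at this
    exact this.symm

/-- A continuous function bounded off one point is bounded there too. -/
theorem bound_of_ne {g : ℂ → ℂ} (hg : DifferentiableOn ℂ g unitDisk) {a : ℂ}
    (h : ∀ z ∈ unitDisk, z ≠ a → ‖g z‖ ≤ 1) : ∀ z ∈ unitDisk, ‖g z‖ ≤ 1 := by
  intro z hz
  by_cases hza : z = a
  · subst hza
    have hc : ContinuousAt g z := (hg.differentiableAt (isOpen_unitDisk.mem_nhds hz)).continuousAt
    have hl : Tendsto (fun w => ‖g w‖) (𝓝[≠] z) (𝓝 ‖g z‖) := hc.norm.tendsto.mono_left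
      nhdsWithin_le_nhds
    refine le_of_tendsto hl ?_
    have h1 : ∀ᶠ w in 𝓝[≠] z, w ∈ unitDisk :=
      nhdsWithin_le_nhds (isOpen_unitDisk.mem_nhds hz)
    filter_upwards [h1, self_mem_nhdsWithin] with w hw hne
    exact h w hw hne
  · exact h z hz hza

theorem one_factor {f : ℂ → ℂ} (hf : DifferentiableOn ℂ f unitDisk)
    (hb : ∀ z ∈ unitDisk, ‖f z‖ ≤ 1) {a : ℂ} (ha : ‖a‖ < 1) (ha0 : a ≠ 0) (hfa : f a = 0) :
    ∃ g : ℂ → ℂ, DifferentiableOn ℂ g unitDisk ∧ (∀ z ∈ unitDisk, ‖g z‖ ≤ 1) ∧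
      ∀ z ∈ unitDisk, f z = blaschkeFactor a z * g z := by
  obtain ⟨hd, he⟩ := dslope_factor hf ha hfa
  have hn0 : (‖a‖ : ℂ) ≠ 0 := by exact_mod_cast norm_ne_zero_iff.2 ha0
  have hfac : ∀ z ∈ unitDisk, f z = blaschkeFactor a z *
      (-(a / ‖a‖) * (1 - (starRingEnd ℂ) a * z) * dslope f a z) := by
    intro z hz
    have h0 := bl_den_ne ha (mem_unitDisk.1 hz)
    conv_lhs => rw [he z]
    unfold blaschkeFactor
    generalize (starRingEnd ℂ) a = c at *
    have h0' : 1 - z * c ≠ 0 := by rwa [mul_comm]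
    field_simp
    ring
  have hgd : DifferentiableOn ℂ
      (fun z => -(a / ‖a‖) * (1 - (starRingEnd ℂ) a * z) * dslope f a z) unitDisk := by
    apply DifferentiableOn.mul _ hd
    fun_prop
  refine ⟨_, hgd, bound_of_ne (a := a) hgd ?_, hfac⟩
  intro z hz hne
  have h1 := schwarz_pick hf hb ha hfa (mem_unitDisk.1 hz)
  rw [← norm_blaschke ha0, hfac z hz, norm_mul] at h1
  have h2 := norm_pos_iff.2 (blaschke_ne ha0 ha (mem_unitDisk.1 hz) hne)
  exact (mul_le_iff_le_one_right h2).1 h1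

theorem zero_factor {f : ℂ → ℂ} (hf : DifferentiableOn ℂ f unitDisk)
    (hb : ∀ z ∈ unitDisk, ‖f z‖ ≤ 1) (hfa : f 0 = 0) :
    ∃ g : ℂ → ℂ, DifferentiableOn ℂ g unitDisk ∧ (∀ z ∈ unitDisk, ‖g z‖ ≤ 1) ∧
      ∀ z, f z = z * g z := by
  obtain ⟨hd, he⟩ := dslope_factor hf (a := 0) (by simp) hfa
  refine ⟨_, hd, bound_of_ne (a := 0) hd ?_, by simpa using he⟩
  intro z hz hne
  have h1 := schwarz_pick hf hb (a := 0) (by simp) hfa (mem_unitDisk.1 hz)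
  rw [he z] at h1
  simp only [sub_zero, zero_sub, map_zero, zero_mul, div_one, norm_neg, norm_mul] at h1
  exact (mul_le_iff_le_one_right (norm_pos_iff.2 hne)).1 h1

theorem zero_power (m : ℕ) : ∀ f : ℂ → ℂ, DifferentiableOn ℂ f unitDisk →
    (∀ z ∈ unitDisk, ‖f z‖ ≤ 1) → analyticOrderAt f 0 = m →
    ∃ g : ℂ → ℂ, DifferentiableOn ℂ g unitDisk ∧ (∀ z ∈ unitDisk, ‖g z‖ ≤ 1) ∧ g 0 ≠ 0 ∧
      ∀ z, f z = z ^ m * g z := by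
  have h0 : (0:ℂ) ∈ unitDisk := by simp [unitDisk]
  induction m with
  | zero =>
    intro f hf hb hm
    refine ⟨f, hf, hb, ?_, by simp⟩
    have ha : AnalyticAt ℂ f 0 := hf.analyticAt (isOpen_unitDisk.mem_nhds h0)
    exact ha.analyticOrderAt_eq_zero.1 (by simpa using hm)
  | succ m ih =>
    intro f hf hb hm
    have ha : AnalyticAt ℂ f 0 := hf.analyticAt (isOpen_unitDisk.mem_nhds h0)
    have hf0 : f 0 = 0 := by
      by_contra h
      rw [ha.analyticOrderAt_eq_zero.2 h] at hm
      have h2 : ((0:ℕ) : ℕ∞) = ((m + 1 : ℕ) : ℕ∞) := hm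
      exact absurd (Nat.cast_injective h2) (by simp)
    obtain ⟨g, hg, hgb, hfg⟩ := zero_factor hf hb hf0
    have hga : AnalyticAt ℂ g 0 := hg.analyticAt (isOpen_unitDisk.mem_nhds h0)
    have hfe : f = (fun z => z) * g := funext hfg
    have hord : analyticOrderAt (fun z : ℂ => z) 0 = 1 := by
      have hid : AnalyticAt ℂ (fun z : ℂ => z) 0 := analyticAt_id
      have := (hid.analyticOrderAt_eq_natCast (n := 1)).2 ⟨fun _ => 1, analyticAt_const, by simp, by simp⟩
      simpa using this
    rw [hfe, analyticOrderAt_mul (f := fun z : ℂ => z) analyticAt_id hga, hord] at hm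
    have hgm : analyticOrderAt g 0 = m := by
      push_cast at hm
      rw [add_comm] at hm
      exact (ENat.add_left_injective_of_ne_top (by simp)) hm
    obtain ⟨k, hk, hkb, hk0, hgk⟩ := ih g hg hgb hgm
    refine ⟨k, hk, hkb, hk0, fun z => ?_⟩
    rw [hfg, hgk]; ring

theorem order_ne_top {f : ℂ → ℂ} (hf : DifferentiableOn ℂ f unitDisk)
    (hnz : ¬ EqOn f 0 unitDisk) : analyticOrderAt f 0 ≠ ⊤ := by
  intro h
  rw [analyticOrderAt_eq_top] at h
  apply hnz
  have ha : AnalyticOnNhd ℂ f unitDisk := hf.analyticOnNhd isOpen_unitDisk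
  exact ha.eqOn_zero_of_preconnected_of_eventuallyEq_zero
    (convex_ball (0:ℂ) 1).isPreconnected (by simp [unitDisk]) h

theorem exists_min_zero {f : ℂ → ℂ} (hf : DifferentiableOn ℂ f unitDisk)
    (hz : ∃ z ∈ unitDisk, f z = 0) :
    ∃ a ∈ unitDisk, f a = 0 ∧ ∀ z ∈ unitDisk, f z = 0 → ‖a‖ ≤ ‖z‖ := by
  obtain ⟨z0, hz0, hf0⟩ := hz
  have hsub : Metric.closedBall (0:ℂ) ‖z0‖ ⊆ unitDisk := by
    intro w hw
    have : ‖w‖ ≤ ‖z0‖ := by simpa using hw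
    exact mem_unitDisk.2 (this.trans_lt (mem_unitDisk.1 hz0))
  have hcl : IsClosed (Metric.closedBall (0:ℂ) ‖z0‖ ∩ f ⁻¹' {0}) :=
    (hf.continuousOn.mono hsub).preimage_isClosed_of_isClosed Metric.isClosed_closedBall
      isClosed_singleton
  have hcpt : IsCompact (Metric.closedBall (0:ℂ) ‖z0‖ ∩ f ⁻¹' {0}) :=
    (isCompact_closedBall 0 ‖z0‖).of_isClosed_subset hcl inter_subset_left
  obtain ⟨a, ha, hmin⟩ := hcpt.exists_isMinOn ⟨z0, by simp [hf0]⟩ continuous_norm.continuousOn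
  have ha1 : ‖a‖ ≤ ‖z0‖ := by simpa using ha.1
  refine ⟨a, hsub ha.1, ha.2, fun z hz hfz => ?_⟩
  by_cases h : ‖z‖ ≤ ‖z0‖
  · exact hmin ⟨by simpa using h, hfz⟩
  · linarith

theorem prod_form (F : ℕ → ℂ → ℂ) (a : ℕ → ℂ) (m n : ℕ) (z : ℂ)
    (hstep : ∀ k < m + n, F k z = blaschkeFactor (a k) z * F (k + 1) z) :
    F m z = (∏ k ∈ Finset.range n, blaschkeFactor (a (m + k)) z) * F (m + n) z := by
  induction n with
  | zero => simp
  | succ n ih =>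
    rw [ih fun k hk => hstep k (by omega), Finset.prod_range_succ,
      hstep (m + n) (by omega)]
    rw [mul_assoc]; rfl

theorem bl_multipliable (a : ℕ → ℂ) (ha : ∀ k, ‖a k‖ < 1) (ha0 : ∀ k, a k ≠ 0)
    (hs : Summable fun k => 1 - ‖a k‖) (z : ℂ) (hz : ‖z‖ < 1) :
    Multipliable fun k => blaschkeFactor (a k) z := by
  have : Multipliable fun k => 1 + (blaschkeFactor (a k) z - 1) := by
    apply multipliable_one_add_of_summable
    refine Summable.of_nonneg_of_le (fun k => norm_nonneg _)
      (fun k => blaschke_sub_one (ha0 k) (ha k) hz) (hs.mul_left _)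
  simpa using this

theorem bl_diff (a : ℕ → ℂ) (ha : ∀ k, ‖a k‖ < 1) (ha0 : ∀ k, a k ≠ 0)
    (hs : Summable fun k => 1 - ‖a k‖) :
    DifferentiableOn ℂ (fun z => ∏' k, blaschkeFactor (a k) z) unitDisk := by
  intro z hz
  obtain ⟨ρ, h1, h2⟩ := exists_between (mem_unitDisk.1 hz)
  have hsub : Metric.ball (0:ℂ) ρ ⊆ unitDisk := Metric.ball_subset_ball h2.le
  have hP := Summable.hasProdLocallyUniformlyOn_nat_one_add (K := Metric.ball (0:ℂ) ρ)
    (f := fun k z => blaschkeFactor (a k) z - 1) (u := fun k => 2 / (1 - ρ) * (1 - ‖a k‖))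
    Metric.isOpen_ball (hs.mul_left _)
    (Eventually.of_forall fun k w hw => by
      have hw1 : ‖w‖ < ρ := by simpa using hw
      refine (blaschke_sub_one (ha0 k) (ha k) (hw1.trans h2)).trans ?_
      have h3 : 0 < 1 - ρ := by linarith
      have h4 : 0 ≤ 1 - ‖a k‖ := by linarith [ha k]
      gcongr)
    (fun k => ((blaschke_diff (ha k)).continuousOn.mono hsub).sub continuousOn_const)
  have hd : DifferentiableOn ℂ (fun x => ∏' k, (1 + (blaschkeFactor (a k) x - 1)))
      (Metric.ball 0 ρ) := by
    refine TendstoLocallyUniformlyOn.differentiableOn hP (Eventually.of_forall fun s => ?_)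
      Metric.isOpen_ball
    apply DifferentiableOn.fun_finsetProd
    intro k _
    exact (((blaschke_diff (ha k)).mono hsub).sub_const 1).const_add 1
  simp only [add_sub_cancel] at hd
  exact (hd.differentiableAt (Metric.isOpen_ball.mem_nhds (by simpa using h1))).differentiableWithinAt

theorem inf_blaschke (F : ℕ → ℂ → ℂ) (a : ℕ → ℂ)
    (hFd : ∀ n, DifferentiableOn ℂ (F n) unitDisk) (hFb : ∀ n, ∀ z ∈ unitDisk, ‖F n z‖ ≤ 1)
    (ha : ∀ n, ‖a n‖ < 1) (ha0 : ∀ n, a n ≠ 0)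
    (hmin : ∀ n, ∀ z ∈ unitDisk, F n z = 0 → ‖a n‖ ≤ ‖z‖)
    (hstep : ∀ n, ∀ z ∈ unitDisk, F n z = blaschkeFactor (a n) z * F (n + 1) z)
    (hF0 : F 0 0 ≠ 0) :
    (Summable fun k => 1 - ‖a k‖) ∧
    DifferentiableOn ℂ (fun z => ∏' k, blaschkeFactor (a k) z) unitDisk ∧
    (∀ z ∈ unitDisk, ‖∏' k, blaschkeFactor (a k) z‖ ≤ 1) ∧
    ∃ g : ℂ → ℂ, DifferentiableOn ℂ g unitDisk ∧ (∀ z ∈ unitDisk, ‖g z‖ ≤ 1) ∧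
      (∀ z ∈ unitDisk, g z ≠ 0) ∧
      ∀ z ∈ unitDisk, F 0 z = (∏' k, blaschkeFactor (a k) z) * g z := by
  have h0d : (0:ℂ) ∈ unitDisk := by simp [unitDisk]
  have hs : Summable fun k => 1 - ‖a k‖ := by
    refine summable_of_sum_range_le (c := -Real.log ‖F 0 0‖) (fun n => by linarith [ha n])
      fun n => ?_
    have h1 := prod_form F a 0 n 0 fun k _ => hstep k 0 h0d
    have h2 : ‖F 0 0‖ ≤ ∏ k ∈ Finset.range n, ‖a k‖ := by
      rw [h1, norm_mul, norm_prod]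
      have e : ∀ k, ‖blaschkeFactor (a (0 + k)) 0‖ = ‖a k‖ := by
        intro k
        rw [norm_blaschke (ha0 _)]; simp
      simp only [e]
      exact mul_le_of_le_one_right (by positivity) (hFb _ 0 h0d)
    have h3 := Real.log_le_log (norm_pos_iff.2 hF0) h2
    rw [Real.log_prod (fun k _ => norm_ne_zero_iff.2 (ha0 k))] at h3
    have h4 : ∑ k ∈ Finset.range n, (1 - ‖a k‖) ≤ ∑ k ∈ Finset.range n, -Real.log ‖a k‖ := by
      apply Finset.sum_le_sum
      intro k _
      have := Real.log_le_sub_one_of_pos (norm_pos_iff.2 (ha0 k))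
      linarith
    rw [Finset.sum_neg_distrib] at h4
    linarith
  have hsn : ∀ n, Summable fun k => 1 - ‖a (n + k)‖ := by
    intro n
    have := (summable_nat_add_iff n).2 hs
    simpa only [add_comm] using this
  set T : ℕ → ℂ → ℂ := fun n z => ∏' k, blaschkeFactor (a (n + k)) z with hT
  have hTm : ∀ n, ∀ z ∈ unitDisk, Multipliable fun k => blaschkeFactor (a (n + k)) z :=
    fun n z hz => bl_multipliable (fun k => a (n + k)) (fun k => ha _) (fun k => ha0 _) (hsn n) z
      (mem_unitDisk.1 hz)
  have hTd : ∀ n, DifferentiableOn ℂ (T n) unitDisk :=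
    fun n => bl_diff (fun k => a (n + k)) (fun k => ha _) (fun k => ha0 _) (hsn n)
  have hTlim : ∀ n, ∀ z ∈ unitDisk, Tendsto
      (fun N => ‖∏ k ∈ Finset.range N, blaschkeFactor (a (n + k)) z‖) atTop (𝓝 ‖T n z‖) :=
    fun n z hz => ((hTm n z hz).hasProd.tendsto_prod_nat).norm
  have hTb : ∀ n, ∀ z ∈ unitDisk, ‖T n z‖ ≤ 1 := by
    intro n z hz
    refine le_of_tendsto (hTlim n z hz) (Eventually.of_forall fun N => ?_)
    rw [norm_prod]
    exact Finset.prod_le_one (fun _ _ => norm_nonneg _)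
      fun k _ => norm_blaschke_le (ha0 _) (ha _) (mem_unitDisk.1 hz)
  have hFT : ∀ n, ∀ z ∈ unitDisk, ‖F n z‖ ≤ ‖T n z‖ := by
    intro n z hz
    refine ge_of_tendsto (hTlim n z hz) (Eventually.of_forall fun N => ?_)
    rw [prod_form F a n N z fun k _ => hstep k z hz, norm_mul]
    exact mul_le_of_le_one_right (norm_nonneg _) (hFb _ z hz)
  have hTs : ∀ n, ∀ z ∈ unitDisk, T n z = blaschkeFactor (a n) z * T (n + 1) z := by
    intro n z hz
    have e : ∀ k, n + (k + 1) = n + 1 + k := fun k => by omega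
    have e2 : (fun k => blaschkeFactor (a (n + (k + 1))) z)
        = fun k => blaschkeFactor (a (n + 1 + k)) z := funext fun k => by rw [e]
    have h1 : Multipliable fun k => blaschkeFactor (a (n + (k + 1))) z := by
      rw [e2]
      exact hTm (n + 1) z hz
    have h5 := tprod_eq_zero_mul' (f := fun k => blaschkeFactor (a (n + k)) z) h1
    rw [e2] at h5
    exact h5
  have hlim : Tendsto (fun k => ‖a k‖) atTop (𝓝 1) := by
    have := hs.tendsto_atTop_zero.const_sub 1
    simpa using this
  have hev : ∀ ρ < 1, ∃ n, ∀ k ≥ n, ρ < ‖a k‖ := by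
    intro ρ hρ
    exact eventually_atTop.1 ((tendsto_order.1 hlim).1 ρ hρ)
  have hT0 : T 0 = fun z => ∏' k, blaschkeFactor (a k) z := by
    simp only [hT, zero_add]
  refine ⟨hs, hT0 ▸ hTd 0, fun z hz => ?_, ?_⟩
  · have := hTb 0 z hz
    rwa [hT0] at this
  have hev' : ∀ z : ℂ, ∃ n, z ∈ unitDisk → ∀ k ≥ n, ‖z‖ < ‖a k‖ := by
    intro z
    by_cases hz : z ∈ unitDisk
    · obtain ⟨n, hn⟩ := hev ‖z‖ (mem_unitDisk.1 hz)
      exact ⟨n, fun _ => hn⟩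
    · exact ⟨0, fun h => absurd h hz⟩
  choose N hN using hev'
  have hFne : ∀ n, ∀ z ∈ unitDisk, ‖z‖ < ‖a n‖ → F n z ≠ 0 := by
    intro n z hz hlt h
    have := hmin n z hz h
    linarith
  have hTne : ∀ n, ∀ z ∈ unitDisk, ‖z‖ < ‖a n‖ → T n z ≠ 0 := by
    intro n z hz hlt h
    have h1 := hFT n z hz
    rw [h, norm_zero] at h1
    exact hFne n z hz hlt (norm_le_zero_iff.1 h1)
  have hratio : ∀ z ∈ unitDisk, ∀ n, ‖z‖ < ‖a n‖ →
      F n z / T n z = F (n + 1) z / T (n + 1) z := by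
    intro z hz n hlt
    have hb : blaschkeFactor (a n) z ≠ 0 := by
      apply blaschke_ne (ha0 n) (ha n) (mem_unitDisk.1 hz)
      rintro rfl
      exact lt_irrefl _ hlt
    rw [hstep n z hz, hTs n z hz, mul_div_mul_left _ _ hb]
  have hratio2 : ∀ z ∈ unitDisk, ∀ n, (∀ k ≥ n, ‖z‖ < ‖a k‖) → ∀ m,
      F n z / T n z = F (n + m) z / T (n + m) z := by
    intro z hz n hn m
    induction m with
    | zero => rfl
    | succ m ih => rw [ih, hratio z hz (n + m) (hn _ (by omega))]; rfl
  have hg : ∀ z ∈ unitDisk, ∀ n, (∀ k ≥ n, ‖z‖ < ‖a k‖) →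
      F (N z) z / T (N z) z = F n z / T n z := by
    intro z hz n hn
    rw [hratio2 z hz (N z) (hN z hz) n, hratio2 z hz n hn (N z), add_comm]
  refine ⟨fun z => F (N z) z / T (N z) z, ?_, ?_, ?_, ?_⟩
  · intro z hz
    obtain ⟨ρ, h1, h2⟩ := exists_between (mem_unitDisk.1 hz)
    obtain ⟨n, hn⟩ := hev ρ h2
    have hd : DifferentiableAt ℂ (fun w => F n w / T n w) z :=
      ((hFd n).differentiableAt (isOpen_unitDisk.mem_nhds hz)).div
        ((hTd n).differentiableAt (isOpen_unitDisk.mem_nhds hz))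
        (hTne n z hz (h1.trans (hn n le_rfl)))
    apply DifferentiableAt.differentiableWithinAt
    refine hd.congr_of_eventuallyEq ?_
    have hball : Metric.ball (0:ℂ) ρ ∈ 𝓝 z := Metric.isOpen_ball.mem_nhds (by simpa using h1)
    filter_upwards [hball] with w hw
    have hw1 : ‖w‖ < ρ := by simpa using hw
    exact hg w (mem_unitDisk.2 (hw1.trans h2)) n fun k hk => hw1.trans (hn k hk)
  · intro z hz
    rw [norm_div]
    exact div_le_one_of_le₀ (hFT _ z hz) (norm_nonneg _)
  · intro z hz
    exact div_ne_zero (hFne _ z hz (hN z hz _ le_rfl)) (hTne _ z hz (hN z hz _ le_rfl))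
  · intro z hz
    have hTp : ∀ n, T 0 z * F n z = T n z * F 0 z := by
      intro n
      have h1 := prod_form F a 0 n z fun k _ => hstep k z hz
      have h2 := prod_form T a 0 n z fun k _ => hTs k z hz
      rw [h1, h2, zero_add]; ring
    have hne := hTne _ z hz (hN z hz _ le_rfl)
    have h3 := hTp (N z)
    rw [hT0] at h3
    simp only [] at h3
    rw [← mul_div_assoc, h3, mul_div_cancel_left₀ _ hne]

theorem riesz_nonzero (f : ℂ → ℂ) (hf : DifferentiableOn ℂ f unitDisk)
    (hb : ∀ z ∈ unitDisk, ‖f z‖ ≤ 1) (hf0 : f 0 ≠ 0) (m : ℕ) :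
    ∃ B g : ℂ → ℂ, IsBlaschkeProduct (fun z => z ^ m * B z) ∧ DifferentiableOn ℂ B unitDisk ∧
      (∀ z ∈ unitDisk, ‖B z‖ ≤ 1) ∧ DifferentiableOn ℂ g unitDisk ∧
      (∀ z ∈ unitDisk, ‖g z‖ ≤ 1) ∧ (∀ z ∈ unitDisk, g z ≠ 0) ∧
      ∀ z ∈ unitDisk, f z = B z * g z := by
  have h0d : (0:ℂ) ∈ unitDisk := by simp [unitDisk]
  let S := {f : ℂ → ℂ // DifferentiableOn ℂ f unitDisk ∧ (∀ z ∈ unitDisk, ‖f z‖ ≤ 1) ∧ f 0 ≠ 0}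
  have hnext : ∀ s : S, ∃ (a : ℂ) (t : S), (∃ z ∈ unitDisk, s.1 z = 0) →
      (‖a‖ < 1 ∧ a ≠ 0 ∧ (∀ z ∈ unitDisk, s.1 z = 0 → ‖a‖ ≤ ‖z‖) ∧
        ∀ z ∈ unitDisk, s.1 z = blaschkeFactor a z * t.1 z) := by
    rintro ⟨s, hs1, hs2, hs3⟩
    by_cases hz : ∃ z ∈ unitDisk, s z = 0
    · obtain ⟨a, ha, hsa, hmin⟩ := exists_min_zero hs1 hz
      have ha0 : a ≠ 0 := by rintro rfl; exact hs3 hsa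
      obtain ⟨g, hg, hgb, hsg⟩ := one_factor hs1 hs2 (mem_unitDisk.1 ha) ha0 hsa
      refine ⟨a, ⟨g, hg, hgb, ?_⟩, fun _ => ⟨mem_unitDisk.1 ha, ha0, hmin, hsg⟩⟩
      intro h
      apply hs3
      rw [hsg 0 h0d, h, mul_zero]
    · exact ⟨0, ⟨s, hs1, hs2, hs3⟩, fun h => absurd h hz⟩
  choose A nx hA using hnext
  let F : ℕ → S := fun n => nx^[n] ⟨f, hf, hb, hf0⟩
  have hFs : ∀ n, F (n + 1) = nx (F n) := fun n => Function.iterate_succ_apply' _ _ _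
  by_cases hfin : ∃ n, ¬ ∃ z ∈ unitDisk, (F n).1 z = 0
  · classical
    set n := Nat.find hfin with hn
    have hlt : ∀ k < n, ∃ z ∈ unitDisk, (F k).1 z = 0 := fun k hk => by
      have := Nat.find_min hfin hk
      exact not_not.1 this
    have hne : ∀ z ∈ unitDisk, (F n).1 z ≠ 0 := fun z hz h => Nat.find_spec hfin ⟨z, hz, h⟩
    refine ⟨fun z => ∏ k ∈ Finset.range n, blaschkeFactor (A (F k)) z, (F n).1, ?_, ?_, ?_,
      (F n).2.1, (F n).2.2.1, hne, ?_⟩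
    · refine ⟨m, Or.inl ⟨n, fun k => A (F k), fun k hk => ?_, fun z _ => rfl⟩⟩
      have := hA (F k) (hlt k hk)
      exact ⟨mem_unitDisk.2 this.1, this.2.1⟩
    · apply DifferentiableOn.fun_finsetProd
      intro k hk
      exact blaschke_diff (hA (F k) (hlt k (Finset.mem_range.1 hk))).1
    · intro z hz
      simp only [norm_prod]
      refine Finset.prod_le_one (fun _ _ => norm_nonneg _) fun k hk => ?_
      have := hA (F k) (hlt k (Finset.mem_range.1 hk))
      exact norm_blaschke_le this.2.1 this.1 (mem_unitDisk.1 hz)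
    · intro z hz
      have := prod_form (fun k => (F k).1) (fun k => A (F k)) 0 n z fun k hk => by
        have h1 := (hA (F k) (hlt k (by omega))).2.2.2 z hz
        simp only [hFs]
        exact h1
      simp only [zero_add] at this
      exact this
  · have hinf : ∀ n, ∃ z ∈ unitDisk, (F n).1 z = 0 := fun n => by
      by_contra h; exact hfin ⟨n, h⟩
    obtain ⟨h1, h2, h3, g, hg1, hg2, hg3, hg4⟩ := inf_blaschke (fun n => (F n).1)
      (fun n => A (F n)) (fun n => (F n).2.1) (fun n => (F n).2.2.1)
      (fun n => (hA (F n) (hinf n)).1) (fun n => (hA (F n) (hinf n)).2.1)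
      (fun n => (hA (F n) (hinf n)).2.2.1)
      (fun n z hz => by
        have h1 := (hA (F n) (hinf n)).2.2.2 z hz
        simp only [hFs]
        exact h1) hf0
    refine ⟨_, g, ⟨m, Or.inr ⟨fun n => A (F n), fun k => ?_, h1, fun z _ => rfl⟩⟩, h2, h3, hg1,
      hg2, hg3, hg4⟩
    exact ⟨mem_unitDisk.2 (hA (F k) (hinf k)).1, (hA (F k) (hinf k)).2.1⟩

theorem riesz (f : ℂ → ℂ) (hf : DifferentiableOn ℂ f unitDisk)
    (hb : ∀ z ∈ unitDisk, ‖f z‖ ≤ 1) (hnz : ¬ EqOn f 0 unitDisk) :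
    ∃ B g : ℂ → ℂ, IsBlaschkeProduct B ∧ DifferentiableOn ℂ B unitDisk ∧
      (∀ z ∈ unitDisk, ‖B z‖ ≤ 1) ∧ DifferentiableOn ℂ g unitDisk ∧
      (∀ z ∈ unitDisk, ‖g z‖ ≤ 1) ∧ (∀ z ∈ unitDisk, g z ≠ 0) ∧
      ∀ z ∈ unitDisk, f z = B z * g z := by
  obtain ⟨m, hm⟩ := ENat.ne_top_iff_exists.1 (order_ne_top hf hnz)
  obtain ⟨f0, h1, h2, h3, h4⟩ := zero_power m f hf hb hm.symm
  obtain ⟨B, g, k1, k2, k3, k4, k5, k6, k7⟩ := riesz_nonzero f0 h1 h2 h3 m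
  refine ⟨_, g, k1, ?_, ?_, k4, k5, k6, ?_⟩
  · exact DifferentiableOn.mul (by fun_prop) k2
  · intro z hz
    rw [norm_mul, norm_pow]
    exact mul_le_one₀ (pow_le_one₀ (norm_nonneg _) (mem_unitDisk.1 hz).le) (norm_nonneg _) (k3 z hz)
  · intro z hz
    rw [h4, k7 z hz]; ring

theorem exists_log (g : ℂ → ℂ) (hg : DifferentiableOn ℂ g unitDisk)
    (hb : ∀ z ∈ unitDisk, ‖g z‖ ≤ 1) (hne : ∀ z ∈ unitDisk, g z ≠ 0) :
    ∃ H : ℂ → ℂ, DifferentiableOn ℂ H unitDisk ∧ (∀ z ∈ unitDisk, 0 ≤ (H z).re) ∧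
      ∀ z ∈ unitDisk, g z = Complex.exp (-H z) := by
  have h0d : (0:ℂ) ∈ unitDisk := by simp [unitDisk]
  have hld : DifferentiableOn ℂ (fun z => -(deriv g z / g z)) unitDisk :=
    ((hg.deriv isOpen_unitDisk).div hg hne).neg
  obtain ⟨H, hH0, hH⟩ := (DifferentiableOn.isExactOn_ball hld).with_val_at 0 (-Complex.log (g 0))
  have hexp : ∀ z ∈ unitDisk, g z = Complex.exp (-H z) := by
    have hder : ∀ z ∈ unitDisk, HasDerivAt (fun w => g w * Complex.exp (H w)) 0 z := by
      intro z hz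
      have h1 := (hg.differentiableAt (isOpen_unitDisk.mem_nhds hz)).hasDerivAt
      have h2 := h1.mul ((hH z hz).cexp)
      refine h2.congr_deriv ?_
      have h3 : g z * (deriv g z / g z) = deriv g z := mul_div_cancel₀ _ (hne z hz)
      linear_combination -Complex.exp (H z) * h3
    intro z hz
    have hconst := isOpen_unitDisk.is_const_of_deriv_eq_zero (f := fun w => g w * Complex.exp (H w))
      (convex_ball (0:ℂ) 1).isPreconnected
      (fun z hz => (hder z hz).differentiableAt.differentiableWithinAt)
      (fun z hz => (hder z hz).deriv) hz h0d
    simp only [hH0, Complex.exp_neg, Complex.exp_log (hne 0 h0d)] at hconst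
    rw [mul_inv_cancel₀ (hne 0 h0d)] at hconst
    rw [Complex.exp_neg]
    exact eq_inv_of_mul_eq_one_left hconst
  refine ⟨H, fun z hz => (hH z hz).differentiableAt.differentiableWithinAt, fun z hz => ?_, hexp⟩
  have := hb z hz
  rw [hexp z hz, Complex.norm_exp, Real.exp_le_one_iff, Complex.neg_re] at this
  linarith

theorem main_result (p : ℝ) (hp : 1 < p)
    (I : Set (ℂ → ℂ)) (hI : IsPrimeIdealIn p I)
    (hnz : ∃ f ∈ I, ¬ Set.EqOn f 0 unitDisk)
    (hnd : ¬ IsDenseIn p I) :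
    ∃ B ∈ I, IsBlaschkeProduct B ∧ ¬ Set.EqOn B 0 unitDisk := by
  classical
  have hp0 : 0 < p := by linarith
  have h0d : (0:ℂ) ∈ unitDisk := by simp [unitDisk]
  set χ : ℂ → ℂ := unitDisk.indicator 1 with hχ
  have hχ1 : ∀ z ∈ unitDisk, χ z = 1 := fun z hz => by simp [hχ, hz]
  have hχp : χ ∈ MpClass p := by
    refine mp_of_bounded p hp0 _ ?_ fun z hz => by rw [hχ1 z hz]; simp
    exact (differentiableOn_const (1:ℂ)).congr hχ1
  by_cases hχI : χ ∈ I
  · refine ⟨χ, hχI, ⟨0, Or.inl ⟨0, 0, by simp, fun z hz => by simp [hχ1 z hz]⟩⟩, ?_⟩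
    intro h
    have := h h0d
    rw [hχ1 0 h0d] at this
    simp at this
  have hext : ∀ f ∈ I, ∀ g ∈ MpClass p, EqOn f g unitDisk → g ∈ I := by
    intro f hf g hg hfg
    have h1 : χ * g ∈ I := by
      have h2 : χ * f ∈ I := hI.1.mul_mem χ hχp f hf
      have h3 : χ * g = χ * f := by
        ext z
        by_cases hz : z ∈ unitDisk
        · simp [hfg hz]
        · simp [hχ, hz]
      rwa [h3]
    exact (hI.2 χ hχp g hg h1).resolve_left hχI
  obtain ⟨f, hfI, hfnz⟩ := hnz
  have hfp := hI.1.subset hfI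
  obtain ⟨W, hW, hWre, hWf⟩ := stepA p hp f hfp
  have hhp : (fun z => Complex.exp (-W z)) ∈ MpClass p := by
    refine mp_of_bounded p hp0 _ hW.neg.cexp fun z hz => ?_
    rw [Complex.norm_exp, Real.exp_le_one_iff, Complex.neg_re]
    have := hWre z hz
    linarith
  have hF : (fun z => Complex.exp (-W z)) * f ∈ I := hI.1.mul_mem _ hhp f hfI
  set F : ℂ → ℂ := (fun z => Complex.exp (-W z)) * f with hFdef
  have hFd : DifferentiableOn ℂ F unitDisk := hhp.1.mul hfp.1
  have hFb : ∀ z ∈ unitDisk, ‖F z‖ ≤ 1 := by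
    intro z hz
    simp only [hFdef, Pi.mul_apply, norm_mul, Complex.norm_exp, Complex.neg_re, Real.exp_neg]
    rw [mul_comm, ← div_eq_mul_inv]
    exact div_le_one_of_le₀ (hWf z hz) (Real.exp_pos _).le
  have hFnz : ¬ EqOn F 0 unitDisk := by
    intro h
    apply hfnz
    intro z hz
    have h1 := h hz
    simpa [hFdef, Complex.exp_ne_zero] using h1
  obtain ⟨B, g, hB, hBd, hBb, hgd, hgb, hgne, hFBg⟩ := riesz F hFd hFb hFnz
  have hBp := mp_of_bounded p hp0 B hBd hBb
  have hgp := mp_of_bounded p hp0 g hgd hgb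
  have hBg : B * g ∈ I := by
    refine hext F hF _ ?_ hFBg
    refine mp_of_bounded p hp0 _ (hBd.mul hgd) fun z hz => ?_
    have := hFb z hz
    rwa [hFBg z hz] at this
  rcases hI.2 B hBp g hgp hBg with h | h
  · refine ⟨B, h, hB, fun h0 => hFnz fun z hz => ?_⟩
    rw [hFBg z hz, h0 hz]; simp
  · obtain ⟨H, hH, hHre, hHg⟩ := exists_log g hgd hgb hgne
    exact absurd (stepC p hp I hI hext g h H hH hHre hHg) hnd

/-- A nonzero prime ideal of `M^p` which is not dense in `(M^p, ρ_p)`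
contains a (finite or infinite) Blaschke product which is not identically zero. -/
theorem prime_ideal_not_dense_contains_blaschke (p : ℝ) (hp : 1 < p)
    (I : Set (ℂ → ℂ)) (hI : IsPrimeIdealIn p I)
    (hnz : ∃ f ∈ I, ¬ Set.EqOn f 0 unitDisk)
    (hnd : ¬ IsDenseIn p I) :
    ∃ B ∈ I, IsBlaschkeProduct B ∧ ¬ Set.EqOn B 0 unitDisk := by
  exact main_result p hp I hI hnz hnd
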